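/- arXiv:1105.5066 — 5 statements merged into one kernel-verified Lean document; each statement's English description precedes it below -/
import Mathlib

section
/- Assume Q(h⁰) is compact with nonempty interior and Aᵢ(h⁰) > 0 for every i. Let u ∈ ℝⁿ be such that for every i the real function t ↦ Aᵢ(h⁰ + t·u) has derivative 0 at t = 0. Then there exists a vector a ∈ ℝ³ such that uᵢ = ⟨a, νᵢ⟩ for all i = 1,…,n (i.e., the infinitesimal deformation of the linear family of polyhedra is an infinitesimal parallel translation). This is the Gauss infinitesimal rigidity (Minkowski-type rigidity) of convex polyhedra. -/
open MeasureTheory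
open scoped RealInnerProductSpace

/-- `Q(h) = {x ∈ ℝ³ : ⟨x, νᵢ⟩ ≤ hᵢ for all i}`. -/
def polyQ {n : ℕ} (ν : Fin n → EuclideanSpace ℝ (Fin 3)) (h : Fin n → ℝ) :
    Set (EuclideanSpace ℝ (Fin 3)) :=
  {x | ∀ i, ⟪x, ν i⟫ ≤ h i}

/-- The area (2-dimensional Hausdorff measure) of the `i`-th face
`Fᵢ(h) = Q(h) ∩ {x : ⟨x, νᵢ⟩ = hᵢ}`. -/
noncomputable def faceArea {n : ℕ} (ν : Fin n → EuclideanSpace ℝ (Fin 3)) (h : Fin n → ℝ)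
    (i : Fin n) : ℝ :=
  (μH[2] (polyQ ν h ∩ {x | ⟪x, ν i⟫ = h i})).toReal

section PL
open Set ENNReal

theorem volume_add_le_two_mul_of_isCompact {A B C : Set ℝ} (hA : IsCompact A) (hB : IsCompact B)
    (hA0 : A.Nonempty) (hB0 : B.Nonempty) (hC : ∀ a ∈ A, ∀ b ∈ B, (a + b) / 2 ∈ C) :
    volume A + volume B ≤ 2 * volume C := by
  obtain ⟨a, ha, hamax⟩ := hA.exists_isGreatest hA0
  obtain ⟨b, hb, hbmin⟩ := hB.exists_isLeast hB0
  have hsub : ((fun x => x + b) '' A) ∪ ((fun x => a + x) '' B) ⊆ (fun x : ℝ => 2⁻¹ * x) ⁻¹' C := by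
    rintro x (⟨y, hy, rfl⟩ | ⟨y, hy, rfl⟩)
    · have := hC y hy b hb
      simpa [div_eq_inv_mul] using this
    · have := hC a ha y hy
      simpa [div_eq_inv_mul] using this
  have hvol : volume ((fun x : ℝ => 2⁻¹ * x) ⁻¹' C) = 2 * volume C := by
    rw [Real.volume_preimage_mul_left (by norm_num)]
    norm_num
  have hinter : volume (((fun x => x + b) '' A) ∩ ((fun x => a + x) '' B)) = 0 := by
    refine measure_mono_null (t := {a + b}) ?_ (by simp)
    rintro x ⟨⟨y, hy, rfl⟩, ⟨z, hz, hzy⟩⟩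
    have h1 := hamax hy
    have h2 := hbmin hz
    simp only at hzy ⊢
    rw [mem_singleton_iff]
    linarith
  have hunion := measure_union_add_inter ((fun x => x + b) '' A)
    (t := (fun x => a + x) '' B) (μ := volume)
    ((hB.image (by fun_prop)).measurableSet)
  rw [hinter, add_zero] at hunion
  have e1 : volume ((fun x => x + b) '' A) = volume A := by
    simp
  have e2 : volume ((fun x => a + x) '' B) = volume B := by
    simp
  rw [← hvol, ← e1, ← e2, ← hunion]
  exact measure_mono hsub

theorem volume_add_le_two_mul_of_midpoint {A B C : Set ℝ} (hA : MeasurableSet A)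
    (hB : MeasurableSet B)
    (hA0 : A.Nonempty) (hB0 : B.Nonempty) (hC : ∀ a ∈ A, ∀ b ∈ B, (a + b) / 2 ∈ C) :
    volume A + volume B ≤ 2 * volume C := by
  obtain ⟨a, ha⟩ := hA0
  obtain ⟨b, hb⟩ := hB0
  rw [hA.measure_eq_iSup_isCompact, hB.measure_eq_iSup_isCompact]
  simp only [iSup_and', ]
  refine ENNReal.biSup_add_biSup_le' ⟨∅, by simp⟩ ⟨∅, by simp⟩ ?_
  rintro K ⟨hKA, hK⟩ L ⟨hLB, hL⟩
  refine le_trans ?_ (volume_add_le_two_mul_of_isCompact (A := insert a K) (B := insert b L)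
    (hK.insert a) (hL.insert b) ⟨a, by simp⟩ ⟨b, by simp⟩ ?_)
  · gcongr <;> simp
  · intro x hx y hy
    exact hC x (insert_subset ha hKA hx) y (insert_subset hb hLB hy)

theorem lintegral_eq_lintegral_meas_ofReal_lt {f : ℝ → ℝ≥0∞} (hf : Measurable f)
    (hfin : ∀ x, f x ≠ ∞) :
    ∫⁻ x, f x = ∫⁻ t in Ioi (0 : ℝ), volume {x | ENNReal.ofReal t < f x} := by
  have h := lintegral_eq_lintegral_meas_lt volume (f := fun x => (f x).toReal)
    (Filter.Eventually.of_forall fun x => toReal_nonneg) hf.ennreal_toReal.aemeasurable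
  simp only [ofReal_toReal (hfin _)] at h
  rw [h]
  refine setLIntegral_congr_fun measurableSet_Ioi fun t ht => ?_
  congr 1
  ext x
  simp only [mem_ofPred_eq]
  rw [ofReal_lt_iff_lt_toReal (le_of_lt ht) (hfin x)]

theorem lintegral_add_le_of_iSup_eq_one {f g h : ℝ → ℝ≥0∞} (hf : Measurable f)
    (hg : Measurable g) (hh : Measurable h) (hf1 : ⨆ x, f x = 1) (hg1 : ⨆ x, g x = 1)
    (H : ∀ x y, f x * g y ≤ h ((x + y) / 2) ^ 2) :
    (∫⁻ x, f x) + ∫⁻ x, g x ≤ 2 * ∫⁻ x, h x := by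
  have hfle : ∀ x, f x ≤ 1 := fun x => hf1 ▸ le_iSup f x
  have hgle : ∀ x, g x ≤ 1 := fun x => hg1 ▸ le_iSup g x
  have hhint : ∫⁻ x, min (h x) 1 ≤ ∫⁻ x, h x := lintegral_mono fun x => min_le_left _ _
  refine le_trans ?_ (mul_le_mul_right hhint 2)
  rw [lintegral_eq_lintegral_meas_ofReal_lt hf fun x => ((hfle x).trans_lt one_lt_top).ne,
    lintegral_eq_lintegral_meas_ofReal_lt hg fun x => ((hgle x).trans_lt one_lt_top).ne,
    lintegral_eq_lintegral_meas_ofReal_lt (hh.min measurable_const)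
      fun x => ((min_le_right _ _).trans_lt one_lt_top).ne]
  have mono : ∀ k : ℝ → ℝ≥0∞, Measurable fun t : ℝ => volume {x | ENNReal.ofReal t < k x} := by
    intro k
    refine Antitone.measurable fun s t hst => measure_mono fun x hx => ?_
    exact lt_of_le_of_lt (ENNReal.ofReal_le_ofReal hst) hx
  rw [← lintegral_add_left (mono f), ← lintegral_const_mul _ (mono _)]
  refine lintegral_mono fun t => ?_
  rcases lt_or_ge (ENNReal.ofReal t) 1 with ht | ht
  · refine volume_add_le_two_mul_of_midpoint (measurableSet_lt measurable_const hf)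
      (measurableSet_lt measurable_const hg) ?_ ?_ ?_
    · exact lt_iSup_iff.1 (hf1 ▸ ht)
    · exact lt_iSup_iff.1 (hg1 ▸ ht)
    · intro x hx y hy
      simp only [mem_ofPred_eq] at hx hy ⊢
      refine lt_min ?_ ht
      by_contra hcon
      rw [not_lt] at hcon
      have h1 : f x * g y ≤ ENNReal.ofReal t ^ 2 := (H x y).trans (pow_le_pow_left' hcon 2)
      rw [sq] at h1
      exact absurd (ENNReal.mul_lt_mul hx hy) (not_lt.2 h1)
  · have e1 : {x | ENNReal.ofReal t < f x} = ∅ := by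
      ext x; simpa using (hfle x).trans ht
    have e2 : {x | ENNReal.ofReal t < g x} = ∅ := by
      ext x; simpa using (hgle x).trans ht
    simp [e1, e2]

theorem ennreal_four_mul_le_sq_add (a b : ℝ≥0∞) : 4 * a * b ≤ (a + b) ^ 2 := by
  rcases eq_or_ne a ∞ with rfl | ha
  · simp
  rcases eq_or_ne b ∞ with rfl | hb
  · simp
  lift a to NNReal using ha
  lift b to NNReal using hb
  exact_mod_cast four_mul_le_sq_add a b

theorem lintegral_mul_le_sq_of_bounded {f g h : ℝ → ℝ≥0∞} (hf : Measurable f)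
    (hg : Measurable g) (hh : Measurable h) {a b : ℝ≥0∞} (ha : a ≠ ∞) (hb : b ≠ ∞)
    (hfa : ∀ x, f x ≤ a) (hgb : ∀ x, g x ≤ b)
    (H : ∀ x y, f x * g y ≤ h ((x + y) / 2) ^ 2) :
    (∫⁻ x, f x) * ∫⁻ x, g x ≤ (∫⁻ x, h x) ^ 2 := by
  set F := ⨆ x, f x with hF
  set G := ⨆ x, g x with hG
  have hFtop : F ≠ ∞ := ((iSup_le hfa).trans_lt ha.lt_top).ne
  have hGtop : G ≠ ∞ := ((iSup_le hgb).trans_lt hb.lt_top).ne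
  rcases eq_or_ne F 0 with hF0 | hF0
  · have : ∀ x, f x = 0 := by simpa [hF] using hF0
    simp [this]
  rcases eq_or_ne G 0 with hG0 | hG0
  · have : ∀ x, g x = 0 := by simpa [hG] using hG0
    simp [this]
  set c := (F⁻¹ * G⁻¹) ^ (1 / 2 : ℝ) with hc
  have hc2 : c ^ 2 = F⁻¹ * G⁻¹ := by
    rw [hc, ← ENNReal.rpow_natCast, ← ENNReal.rpow_mul]
    norm_num
  have key := lintegral_add_le_of_iSup_eq_one (f := fun x => F⁻¹ * f x) (g := fun x => G⁻¹ * g x)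
    (h := fun x => c * h x) (hf.const_mul _) (hg.const_mul _) (hh.const_mul _)
    (by rw [← ENNReal.mul_iSup, ← hF, ENNReal.inv_mul_cancel hF0 hFtop])
    (by rw [← ENNReal.mul_iSup, ← hG, ENNReal.inv_mul_cancel hG0 hGtop])
    (by
      intro x y
      rw [mul_pow, hc2]
      calc F⁻¹ * f x * (G⁻¹ * g y) = F⁻¹ * G⁻¹ * (f x * g y) := by ring
        _ ≤ _ := by gcongr; exact H x y)
  rw [lintegral_const_mul _ hf, lintegral_const_mul _ hg, lintegral_const_mul _ hh] at key
  set If := ∫⁻ x, f x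
  set Ig := ∫⁻ x, g x
  set Ih := ∫⁻ x, h x
  have h4 : 4 * (F⁻¹ * If) * (G⁻¹ * Ig) ≤ 4 * (c ^ 2 * Ih ^ 2) := by
    calc 4 * (F⁻¹ * If) * (G⁻¹ * Ig) ≤ (F⁻¹ * If + G⁻¹ * Ig) ^ 2 := ennreal_four_mul_le_sq_add _ _
      _ ≤ (2 * (c * Ih)) ^ 2 := pow_le_pow_left' key 2
      _ = _ := by ring
  rw [mul_assoc, ENNReal.mul_le_mul_iff_right (by norm_num) (by norm_num), hc2] at h4
  have h5 : (F⁻¹ * G⁻¹) * (If * Ig) ≤ (F⁻¹ * G⁻¹) * Ih ^ 2 := by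
    calc _ = F⁻¹ * If * (G⁻¹ * Ig) := by ring
      _ ≤ _ := h4
  rwa [ENNReal.mul_le_mul_iff_right] at h5
  · exact mul_ne_zero (ENNReal.inv_ne_zero.2 hFtop) (ENNReal.inv_ne_zero.2 hGtop)
  · exact ENNReal.mul_ne_top (ENNReal.inv_ne_top.2 hF0) (ENNReal.inv_ne_top.2 hG0)

theorem iSup_lintegral_min_natCast {f : ℝ → ℝ≥0∞} (hf : Measurable f) :
    ⨆ n : ℕ, ∫⁻ x, min (f x) n = ∫⁻ x, f x := by
  rw [← lintegral_iSup (fun n => hf.min measurable_const)]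
  · congr 1
    ext x
    rw [← inf_iSup_eq, ENNReal.iSup_natCast, inf_top_eq]
  · intro m n hmn x
    exact min_le_min_left _ (by exact_mod_cast hmn)

theorem prekopa_leindler_real {f g h : ℝ → ℝ≥0∞} (hf : Measurable f)
    (hg : Measurable g) (hh : Measurable h)
    (H : ∀ x y, f x * g y ≤ h ((x + y) / 2) ^ 2) :
    (∫⁻ x, f x) * ∫⁻ x, g x ≤ (∫⁻ x, h x) ^ 2 := by
  rw [← iSup_lintegral_min_natCast hf, ← iSup_lintegral_min_natCast hg, ENNReal.iSup_mul]
  refine iSup_le fun m => ?_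
  rw [ENNReal.mul_iSup]
  refine iSup_le fun n => ?_
  refine lintegral_mul_le_sq_of_bounded (hf.min measurable_const) (hg.min measurable_const) hh
    (natCast_ne_top m) (natCast_ne_top n) (fun x => min_le_right _ _) (fun x => min_le_right _ _)
    fun x y => ?_
  exact le_trans (mul_le_mul' (min_le_left _ _) (min_le_left _ _)) (H x y)

theorem prekopa_leindler_pi (n : ℕ) {f g h : (Fin n → ℝ) → ℝ≥0∞} (hf : Measurable f)
    (hg : Measurable g) (hh : Measurable h)
    (H : ∀ x y, f x * g y ≤ h ((2⁻¹ : ℝ) • (x + y)) ^ 2) :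
    (∫⁻ x, f x) * ∫⁻ x, g x ≤ (∫⁻ x, h x) ^ 2 := by
  induction n with
  | zero =>
    simp only [lintegral_unique]
    have hv : volume (univ : Set (Fin 0 → ℝ)) = 1 := by simp [volume_pi]
    rw [hv, mul_one, mul_one, mul_one]
    convert H default default
  | succ n ih =>
    have split : ∀ k : (Fin (n + 1) → ℝ) → ℝ≥0∞, Measurable k →
        ∫⁻ x, k x = ∫⁻ s : ℝ, ∫⁻ y : Fin n → ℝ, k (Fin.cons s y) := by
      intro k hk
      have e := (volume_preserving_piFinSuccAbove (fun _ : Fin (n + 1) => ℝ) 0).symm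
      have hm : Measurable fun p : ℝ × (Fin n → ℝ) =>
          k ((MeasurableEquiv.piFinSuccAbove (fun _ : Fin (n + 1) => ℝ) 0).symm p) :=
        hk.comp (MeasurableEquiv.measurable _)
      rw [← e.lintegral_comp_emb (MeasurableEquiv.measurableEmbedding _)]
      refine (lintegral_prod _ hm.aemeasurable).trans ?_
      simp [MeasurableEquiv.piFinSuccAbove, Fin.insertNthEquiv]
    have hcons : Measurable fun p : ℝ × (Fin n → ℝ) => (Fin.cons p.1 p.2 : Fin (n + 1) → ℝ) := by
      rw [measurable_pi_iff]
      intro i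
      refine Fin.cases ?_ (fun j => ?_) i
      · simpa using measurable_fst
      · simp only [Fin.cons_succ]; exact (measurable_pi_apply j).comp measurable_snd
    have hcons' : ∀ s : ℝ, Measurable fun y : Fin n → ℝ => (Fin.cons s y : Fin (n + 1) → ℝ) :=
      fun s => hcons.comp measurable_prodMk_left
    rw [split f hf, split g hg, split h hh]
    refine prekopa_leindler_real (hf.comp hcons).lintegral_prod_right'
      (hg.comp hcons).lintegral_prod_right' (hh.comp hcons).lintegral_prod_right' fun s t => ?_
    refine ih (hf.comp (hcons' s)) (hg.comp (hcons' t)) (hh.comp (hcons' _)) fun x y => ?_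
    have := H (Fin.cons s x) (Fin.cons t y)
    convert this using 4
    ext i
    refine Fin.cases ?_ (fun j => ?_) i
    · simp only [Fin.cons_zero, Pi.smul_apply, Pi.add_apply, smul_eq_mul]
      ring
    · simp [mul_add]

theorem prekopa_leindler_setIntegral {n : ℕ}
    {A B C : Set (EuclideanSpace ℝ (Fin n))} {f g h : EuclideanSpace ℝ (Fin n) → ℝ}
    (hA : IsCompact A) (hB : IsCompact B) (hC : IsCompact C)
    (hf : Continuous f) (hg : Continuous g) (hh : Continuous h)
    (hf0 : ∀ x ∈ A, 0 ≤ f x) (hg0 : ∀ x ∈ B, 0 ≤ g x) (hh0 : ∀ x ∈ C, 0 ≤ h x)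
    (hABC : ∀ x ∈ A, ∀ y ∈ B, (2⁻¹ : ℝ) • (x + y) ∈ C)
    (H : ∀ x ∈ A, ∀ y ∈ B, f x * g y ≤ h ((2⁻¹ : ℝ) • (x + y)) ^ 2) :
    (∫ x in A, f x) * ∫ x in B, g x ≤ (∫ x in C, h x) ^ 2 := by
  have conv : ∀ (S : Set (EuclideanSpace ℝ (Fin n))) (k : EuclideanSpace ℝ (Fin n) → ℝ),
      IsCompact S → Continuous k → (∀ x ∈ S, 0 ≤ k x) → 0 ≤ ∫ x in S, k x ∧
      Measurable (fun y : Fin n → ℝ => S.indicator (fun x => ENNReal.ofReal (k x))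
        (WithLp.toLp 2 y)) ∧
      ENNReal.ofReal (∫ x in S, k x) = ∫⁻ y : Fin n → ℝ,
        S.indicator (fun x => ENNReal.ofReal (k x)) (WithLp.toLp 2 y) := by
    intro S k hS hk hk0
    have hm : Measurable (S.indicator fun x => ENNReal.ofReal (k x)) :=
      hk.measurable.ennreal_ofReal.indicator hS.measurableSet
    have hv := PiLp.volume_preserving_toLp (Fin n)
    refine ⟨setIntegral_nonneg hS.measurableSet hk0, hm.comp hv.measurable, ?_⟩
    rw [hv.lintegral_comp hm, lintegral_indicator hS.measurableSet]
    exact ofReal_integral_eq_lintegral_ofReal (hk.continuousOn.integrableOn_compact hS)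
      (ae_restrict_of_forall_mem hS.measurableSet hk0)
  obtain ⟨f1, f2, f3⟩ := conv A f hA hf hf0
  obtain ⟨g1, g2, g3⟩ := conv B g hB hg hg0
  obtain ⟨h1, h2, h3⟩ := conv C h hC hh hh0
  rw [← ENNReal.ofReal_le_ofReal_iff (sq_nonneg _), ENNReal.ofReal_mul f1, ENNReal.ofReal_pow h1,
    f3, g3, h3]
  refine prekopa_leindler_pi n f2 g2 h2 fun x y => ?_
  by_cases hx : WithLp.toLp 2 x ∈ A
  · by_cases hy : WithLp.toLp 2 y ∈ B
    · have hm := hABC _ hx _ hy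
      have e : WithLp.toLp 2 ((2⁻¹ : ℝ) • (x + y)) =
        (2⁻¹ : ℝ) • (WithLp.toLp 2 x + WithLp.toLp 2 y : EuclideanSpace ℝ (Fin n)) := rfl
      rw [e, indicator_of_mem hx, indicator_of_mem hy, indicator_of_mem hm,
        ← ENNReal.ofReal_mul (hf0 _ hx), ← ENNReal.ofReal_pow (hh0 _ hm)]
      exact ENNReal.ofReal_le_ofReal (H _ hx _ hy)
    · simp [indicator_of_notMem hy]
  · simp [indicator_of_notMem hx]

end PL

section Pyramids
open Set
open scoped Pointwise

variable {n : ℕ} {ν : Fin n → EuclideanSpace ℝ (Fin 3)} {h : Fin n → ℝ}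

/-- The pyramid with apex `0` over the `i`-th face of `Q(h)`, for positive `h`. -/
def facePyramid (ν : Fin n → EuclideanSpace ℝ (Fin 3)) (h : Fin n → ℝ) (i : Fin n) :
    Set (EuclideanSpace ℝ (Fin 3)) :=
  {x | 0 ≤ ⟪x, ν i⟫ ∧ ⟪x, ν i⟫ ≤ h i ∧ ∀ j, h i * ⟪x, ν j⟫ ≤ h j * ⟪x, ν i⟫}

theorem isClosed_polyQ (ν : Fin n → EuclideanSpace ℝ (Fin 3)) (h : Fin n → ℝ) :
    IsClosed (polyQ ν h) := by
  simp only [polyQ, ofPred_forall]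
  exact isClosed_iInter fun i => isClosed_le (by fun_prop) (by fun_prop)

theorem isClosed_facePyramid (ν : Fin n → EuclideanSpace ℝ (Fin 3)) (h : Fin n → ℝ) (i : Fin n) :
    IsClosed (facePyramid ν h i) := by
  have e : facePyramid ν h i = {x | 0 ≤ ⟪x, ν i⟫} ∩ ({x | ⟪x, ν i⟫ ≤ h i} ∩
      ⋂ j, {x | h i * ⟪x, ν j⟫ ≤ h j * ⟪x, ν i⟫}) := by
    ext x; simp [facePyramid]
  rw [e]
  refine (isClosed_le (by fun_prop) (by fun_prop)).inter
    ((isClosed_le (by fun_prop) (by fun_prop)).inter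
      (isClosed_iInter fun j => isClosed_le (by fun_prop) (by fun_prop)))

theorem facePyramid_subset_polyQ (hh : ∀ i, 0 < h i) (i : Fin n) :
    facePyramid ν h i ⊆ polyQ ν h := by
  rintro x ⟨h0, h1, h2⟩ j
  have := (h2 j).trans (mul_le_mul_of_nonneg_left h1 (hh j).le)
  rw [mul_comm (h j)] at this
  exact le_of_mul_le_mul_left this (hh i)

theorem isCompact_polyQ_of_le {h' : Fin n → ℝ} (hc : IsCompact (polyQ ν h)) {c : ℝ} (hcpos : 0 < c)
    (hle : ∀ i, h' i ≤ c * h i) : IsCompact (polyQ ν h') := by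
  refine (hc.smul c).of_isClosed_subset (isClosed_polyQ ν h') fun x hx => ?_
  refine ⟨c⁻¹ • x, fun i => ?_, by simp [smul_smul, hcpos.ne']⟩
  rw [inner_smul_left]
  simp only [conj_trivial]
  rw [inv_mul_le_iff₀ hcpos]
  exact (hx i).trans (hle i)

theorem midpoint_mem_polyQ {h₁ h₂ : Fin n → ℝ} (hmid : ∀ i, h₁ i + h₂ i = 2 * h i)
    {x y : EuclideanSpace ℝ (Fin 3)} (hx : x ∈ polyQ ν h₁) (hy : y ∈ polyQ ν h₂) :
    (2⁻¹ : ℝ) • (x + y) ∈ polyQ ν h := by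
  intro i
  rw [inner_smul_left, inner_add_left]
  simp only [conj_trivial]
  linarith [hx i, hy i, hmid i]

theorem exists_maximal_gauge (hh : ∀ i, 0 < h i) (hc : IsCompact (polyQ ν h))
    (x : EuclideanSpace ℝ (Fin 3)) :
    ∃ i, 0 ≤ ⟪x, ν i⟫ ∧ ∀ j, h i * ⟪x, ν j⟫ ≤ h j * ⟪x, ν i⟫ := by
  have ray : ∀ y : EuclideanSpace ℝ (Fin 3), y ≠ 0 → ∃ i, 0 ≤ ⟪y, ν i⟫ := by
    intro y hy
    by_contra! hcon
    obtain ⟨C, hC⟩ := hc.isBounded.exists_norm_le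
    have hmem : ((|C| + 1) / ‖y‖) • y ∈ polyQ ν h := by
      intro i
      rw [inner_smul_left]
      simp only [conj_trivial]
      have h1 : 0 ≤ (|C| + 1) / ‖y‖ := by positivity
      nlinarith [hcon i, hh i]
    have := hC _ hmem
    rw [norm_smul, Real.norm_of_nonneg (by positivity), div_mul_cancel₀ _ (norm_ne_zero_iff.2 hy)]
      at this
    linarith [le_abs_self C]
  obtain ⟨y, hy⟩ := exists_ne (0 : EuclideanSpace ℝ (Fin 3))
  obtain ⟨i0, -⟩ := ray y hy
  have : Nonempty (Fin n) := ⟨i0⟩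
  obtain ⟨i, hi⟩ := Finite.exists_max fun i => ⟪x, ν i⟫ / h i
  refine ⟨i, ?_, fun j => ?_⟩
  · rcases eq_or_ne x 0 with rfl | hx
    · simp
    obtain ⟨k, hk⟩ := ray x hx
    have h1 : 0 ≤ ⟪x, ν i⟫ / h i := (div_nonneg hk (hh k).le).trans (hi k)
    rwa [le_div_iff₀ (hh i), zero_mul] at h1
  · have := hi j
    rw [div_le_div_iff₀ (hh j) (hh i)] at this
    linarith

theorem volume_polyQ_le_sum (hh : ∀ i, 0 < h i) (hc : IsCompact (polyQ ν h))
    {h' : Fin n → ℝ} (hh' : ∀ i, 0 < h' i) :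
    volume.real (polyQ ν h') ≤ ∑ i, (h' i / h i) ^ 3 * volume.real (facePyramid ν h i) := by
  have hsub : polyQ ν h' ⊆ ⋃ i, (h' i / h i) • facePyramid ν h i := by
    intro x hx
    obtain ⟨i, hi0, hi⟩ := exists_maximal_gauge hh hc x
    refine mem_iUnion.2 ⟨i, (mem_smul_set_iff_inv_smul_mem₀ (div_pos (hh' i) (hh i)).ne' _ _).2 ?_⟩
    have hq : 0 < (h' i / h i)⁻¹ := inv_pos.2 (div_pos (hh' i) (hh i))
    refine ⟨?_, ?_, fun j => ?_⟩ <;> simp only [inner_smul_left, conj_trivial]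
    · exact mul_nonneg hq.le hi0
    · rw [inv_div, div_mul_eq_mul_div, div_le_iff₀ (hh' i)]
      exact mul_le_mul_of_nonneg_left (hx i) (hh i).le
    · have := mul_le_mul_of_nonneg_left (hi j) hq.le
      linarith
  have hcp : ∀ i, IsCompact (facePyramid ν h i) := fun i =>
    hc.of_isClosed_subset (isClosed_facePyramid ν h i) (facePyramid_subset_polyQ hh i)
  calc volume.real (polyQ ν h') ≤ volume.real (⋃ i, (h' i / h i) • facePyramid ν h i) :=
        measureReal_mono hsub (isCompact_iUnion fun i => (hcp i).smul _).measure_ne_top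
    _ ≤ ∑ i, volume.real ((h' i / h i) • facePyramid ν h i) := measureReal_iUnion_fintype_le _
    _ = _ := by
      refine Finset.sum_congr rfl fun i _ => ?_
      rw [measureReal_def, Measure.addHaar_smul_of_nonneg _ (div_pos (hh' i) (hh i)).le,
        ENNReal.toReal_mul, ENNReal.toReal_ofReal (by have := hh i; have := hh' i; positivity)]
      simp [measureReal_def]

theorem sum_volume_facePyramid_le (hunit : ∀ i, ‖ν i‖ = 1) (hdist : Function.Injective ν)
    (hh : ∀ i, 0 < h i) (hc : IsCompact (polyQ ν h)) :
    ∑ i, volume.real (facePyramid ν h i) ≤ volume.real (polyQ ν h) := by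
  have hcp : ∀ i, IsCompact (facePyramid ν h i) := fun i =>
    hc.of_isClosed_subset (isClosed_facePyramid ν h i) (facePyramid_subset_polyQ hh i)
  have hdisj : Pairwise (Function.onFun (AEDisjoint volume) (facePyramid ν h)) := by
    intro i j hij
    have hw : h i • ν j - h j • ν i ≠ 0 := by
      intro h0
      have h1 : h i • ν j = h j • ν i := sub_eq_zero.1 h0
      have h2 : h i = h j := by
        have := congrArg norm h1
        simpa [norm_smul, hunit, abs_of_pos (hh i), abs_of_pos (hh j)] using this
      rw [h2] at h1
      exact hij (hdist (smul_right_injective _ (hh j).ne' h1)).symm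
    refine measure_mono_null (t := (LinearMap.ker (innerₗ (EuclideanSpace ℝ (Fin 3))
      (h i • ν j - h j • ν i)) : Set (EuclideanSpace ℝ (Fin 3)))) ?_ ?_
    · rintro x ⟨⟨-, -, hi⟩, ⟨-, -, hj⟩⟩
      rw [SetLike.mem_coe, LinearMap.mem_ker, innerₗ_apply_apply, inner_sub_left,
        inner_smul_left, inner_smul_left, conj_trivial, conj_trivial, real_inner_comm x,
        real_inner_comm x]
      linarith [hi j, hj i]
    · refine Measure.addHaar_submodule _ _ fun htop => hw ?_
      have : h i • ν j - h j • ν i ∈ LinearMap.ker (innerₗ (EuclideanSpace ℝ (Fin 3))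
        (h i • ν j - h j • ν i)) := htop ▸ Submodule.mem_top
      simpa only [LinearMap.mem_ker, innerₗ_apply_apply, inner_self_eq_zero] using this
  have key := measure_iUnion₀ (μ := volume) hdisj
    fun i => (hcp i).measurableSet.nullMeasurableSet
  rw [tsum_fintype] at key
  have hle : ∑ i, volume (facePyramid ν h i) ≤ volume (polyQ ν h) := by
    rw [← key]
    exact measure_mono (iUnion_subset fun i => facePyramid_subset_polyQ hh i)
  have := ENNReal.toReal_mono hc.measure_ne_top hle
  rwa [ENNReal.toReal_sum fun i _ => (hcp i).measure_ne_top] at this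

theorem volume_polyQ_eq_sum (hunit : ∀ i, ‖ν i‖ = 1) (hdist : Function.Injective ν)
    (hh : ∀ i, 0 < h i) (hc : IsCompact (polyQ ν h)) :
    volume.real (polyQ ν h) = ∑ i, volume.real (facePyramid ν h i) := by
  refine le_antisymm ?_ (sum_volume_facePyramid_le hunit hdist hh hc)
  refine (volume_polyQ_le_sum hh hc hh).trans_eq (Finset.sum_congr rfl fun i _ => ?_)
  rw [div_self (hh i).ne', one_pow, one_mul]

theorem mul_volume_facePyramid_le_slab (hh : ∀ i, 0 < h i) (hc : IsCompact (polyQ ν h)) (i : Fin n)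
    {δ : ℝ} (hδ0 : 0 ≤ δ) (hδ1 : δ < 1) :
    δ * volume.real (facePyramid ν h i) ≤
      volume.real (polyQ ν h ∩ {x | (1 - δ) * h i ≤ ⟪x, ν i⟫}) := by
  have hcp : IsCompact (facePyramid ν h i) :=
    hc.of_isClosed_subset (isClosed_facePyramid ν h i) (facePyramid_subset_polyQ hh i)
  have hd : 0 < 1 - δ := by linarith
  have hsub : facePyramid ν h i ⊆ (polyQ ν h ∩ {x | (1 - δ) * h i ≤ ⟪x, ν i⟫}) ∪
      (1 - δ) • facePyramid ν h i := by
    intro x hx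
    rcases le_total ((1 - δ) * h i) ⟪x, ν i⟫ with hle | hle
    · exact Or.inl ⟨facePyramid_subset_polyQ hh i hx, hle⟩
    · refine Or.inr ((mem_smul_set_iff_inv_smul_mem₀ hd.ne' _ _).2 ?_)
      obtain ⟨hx0, -, hx2⟩ := hx
      have hq : 0 < (1 - δ)⁻¹ := inv_pos.2 hd
      refine ⟨?_, ?_, fun j => ?_⟩ <;> simp only [inner_smul_left, conj_trivial]
      · exact mul_nonneg hq.le hx0
      · rwa [inv_mul_le_iff₀ hd]
      · have := mul_le_mul_of_nonneg_left (hx2 j) hq.le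
        linarith
  have hfin : volume (polyQ ν h ∩ {x | (1 - δ) * h i ≤ ⟪x, ν i⟫}) ≠ ⊤ :=
    ((measure_mono inter_subset_left).trans_lt hc.measure_lt_top).ne
  have h1 := (measureReal_mono hsub (measure_union_lt_top hfin.lt_top
    (hcp.smul _).measure_lt_top).ne).trans (measureReal_union_le _ _)
  have h2 : volume.real ((1 - δ) • facePyramid ν h i) =
      (1 - δ) ^ 3 * volume.real (facePyramid ν h i) := by
    rw [measureReal_def, Measure.addHaar_smul_of_nonneg _ hd.le, ENNReal.toReal_mul,
      ENNReal.toReal_ofReal (by positivity)]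
    simp [measureReal_def]
  rw [h2] at h1
  have h3 : (1 - δ) ^ 3 ≤ 1 - δ := by nlinarith [mul_nonneg hδ0 hd.le]
  have h4 := mul_le_mul_of_nonneg_right h3 (measureReal_nonneg (μ := volume)
    (s := facePyramid ν h i))
  linarith

end Pyramids

section PyramidVolume
open Set ENNReal
open scoped Pointwise

variable {n : ℕ} {ν : Fin n → EuclideanSpace ℝ (Fin 3)} {h : Fin n → ℝ}

theorem facePyramid_inter_slice (hh : ∀ i, 0 < h i) (i : Fin n) {s : ℝ} (hs : 0 < s)
    (hsi : s ≤ h i) :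
    facePyramid ν h i ∩ {x | ⟪x, ν i⟫ = s} =
      (s / h i) • (polyQ ν h ∩ {x | ⟪x, ν i⟫ = h i}) := by
  have hi := hh i
  ext x
  rw [mem_smul_set_iff_inv_smul_mem₀ (div_pos hs hi).ne']
  simp only [facePyramid, polyQ, mem_inter_iff, mem_ofPred_eq, inner_smul_left, conj_trivial,
    inv_div]
  constructor
  · rintro ⟨⟨-, -, hx⟩, rfl⟩
    refine ⟨fun j => ?_, ?_⟩
    · rw [div_mul_eq_mul_div, div_le_iff₀ hs]
      exact hx j
    · field_simp
  · rintro ⟨hx, hxi⟩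
    have e : ⟪x, ν i⟫ = s := by
      field_simp at hxi
      exact hxi
    refine ⟨⟨e ▸ hs.le, e ▸ hsi, fun j => ?_⟩, e⟩
    have := hx j
    rwa [div_mul_eq_mul_div, div_le_iff₀ hs, ← e] at this

theorem exists_volume_facePyramid_eq : ∃ κ : ℝ, 0 < κ ∧ ∀ {n : ℕ}
    {ν : Fin n → EuclideanSpace ℝ (Fin 3)} {h : Fin n → ℝ}, (∀ i, ‖ν i‖ = 1) → (∀ i, 0 < h i) →
    ∀ i, volume.real (facePyramid ν h i) = h i * (κ * faceArea ν h i) := by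
  obtain ⟨c, hc⟩ : ∃ c, c = Measure.addHaarScalarFactor
    (volume : Measure (EuclideanSpace ℝ (Fin 2))) μH[(2 : ℕ)] := ⟨_, rfl⟩
  have hc0 : c ≠ 0 := by
    rw [hc]; exact Measure.addHaarScalarFactor_volume_hausdorffMeasure_ne_zero 2
  refine ⟨c / 3, by positivity, ?_⟩
  intro n ν h hunit hh i
  have hv : ν i ≠ 0 := by
    rw [← norm_ne_zero_iff, hunit]; exact one_ne_zero
  have hi := hh i
  have hslice : ∀ s : ℝ, s ≠ 0 → Measure.euclideanHausdorffMeasure 2 (facePyramid ν h i ∩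
      AffineSubspace.mk' (s • ν i +ᵥ (0 : EuclideanSpace ℝ (Fin 3))) (ℝ ∙ ν i)ᗮ) =
      (Ioc 0 (h i)).indicator (fun s => ENNReal.ofReal ((s / h i) ^ 2)) s *
        (c * μH[2] (polyQ ν h ∩ {x | ⟪x, ν i⟫ = h i})) := by
    intro s hs0
    have e : ((AffineSubspace.mk' (s • ν i +ᵥ (0 : EuclideanSpace ℝ (Fin 3))) (ℝ ∙ ν i)ᗮ) :
        Set (EuclideanSpace ℝ (Fin 3))) = {x | ⟪x, ν i⟫ = s} := by
      ext x
      rw [SetLike.mem_coe, AffineSubspace.mem_mk', Submodule.mem_orthogonal_singleton_iff_inner_left]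
      simp [inner_sub_left, inner_smul_left, hunit, sub_eq_zero]
    rw [e]
    by_cases hs : s ∈ Ioc 0 (h i)
    · rw [facePyramid_inter_slice hh i hs.1 hs.2, indicator_of_mem hs,
        Measure.euclideanHausdorffMeasure_smul₀ _ (div_pos hs.1 hi).ne',
        Measure.euclideanHausdorffMeasure_def, ← hc, Measure.smul_apply, ENNReal.smul_def,
        ENNReal.smul_def, smul_eq_mul, smul_eq_mul, ENNReal.ofReal_pow (div_pos hs.1 hi).le,
        ← Real.enorm_of_nonneg (div_pos hs.1 hi).le, Nat.cast_ofNat]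
      rfl
    · have : facePyramid ν h i ∩ {x | ⟪x, ν i⟫ = s} = ∅ := by
        refine eq_empty_iff_forall_notMem.2 ?_
        rintro x ⟨⟨h0, h1, -⟩, rfl⟩
        exact hs ⟨h0.lt_of_ne' hs0, h1⟩
      rw [this, indicator_of_notMem hs]
      simp
  have key := EuclideanGeometry.euclideanHausdorffMeasure_eq_lintegral
    (0 : EuclideanSpace ℝ (Fin 3)) hv (isClosed_facePyramid ν h i).measurableSet
  rw [finrank_euclideanSpace_fin, EuclideanSpace.euclideanHausdorffMeasure_eq_volume] at key
  have hae : ∀ᵐ s : ℝ, s ≠ 0 := by simp [ae_iff]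
  rw [lintegral_congr_ae (hae.mono hslice), lintegral_mul_const _
    ((by fun_prop : Measurable fun s : ℝ => ENNReal.ofReal ((s / h i) ^ 2)).indicator
      measurableSet_Ioc), lintegral_indicator measurableSet_Ioc,
    ← ofReal_integral_eq_lintegral_ofReal] at key
  · rw [← intervalIntegral.integral_of_le hi.le] at key
    have hint : ∫ s in (0 : ℝ)..h i, (s / h i) ^ 2 = h i / 3 := by
      simp only [div_pow]
      rw [intervalIntegral.integral_div, integral_pow]
      field_simp
      norm_num
      ring
    rw [hint] at key
    rw [measureReal_def, key, faceArea, ENNReal.toReal_mul, ENNReal.toReal_mul, ENNReal.toReal_mul,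
      ENNReal.toReal_ofReal (by positivity)]
    simp [hunit]
    ring
  · exact ((by fun_prop : Continuous fun s : ℝ => (s / h i) ^ 2).integrableOn_Ioc)
  · exact ae_of_all _ fun s => sq_nonneg _

end PyramidVolume

section Scalar
open Filter Topology

/-- A function whose increments satisfy a linear lower bound up to a quadratic error satisfies
the linear lower bound without error. -/
theorem mul_le_sub_of_forall_increment {f : ℝ → ℝ} {β C t : ℝ} (ht : 0 ≤ t)
    (hf : ∀ x y, 0 ≤ x → x ≤ y → y ≤ t → β * (y - x) - C * (y - x) ^ 2 ≤ f y - f x) :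
    β * t ≤ f t - f 0 := by
  have key : ∀ N : ℕ, β * t - C * t ^ 2 * (1 / ((N : ℝ) + 1)) ≤ f t - f 0 := by
    intro N
    obtain ⟨δ, hδ⟩ : ∃ δ, δ = t / ((N : ℝ) + 1) := ⟨_, rfl⟩
    have hN : (0 : ℝ) < (N : ℝ) + 1 := by positivity
    have hδ0 : 0 ≤ δ := by rw [hδ]; positivity
    have hδt : ((N : ℝ) + 1) * δ = t := by rw [hδ]; field_simp
    have step : ∀ k : ℕ, k ≤ N + 1 → (k : ℝ) * (β * δ - C * δ ^ 2) ≤ f (k * δ) - f 0 := by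
      intro k
      induction k with
      | zero => simp
      | succ k ih =>
        intro hk
        have hk' : ((k : ℝ) + 1) ≤ (N : ℝ) + 1 := by exact_mod_cast hk
        have h1 := ih (by omega)
        have h2 := hf (k * δ) ((k + 1) * δ) (by positivity) (by nlinarith)
          (hδt ▸ mul_le_mul_of_nonneg_right hk' hδ0)
        have e : ((k : ℝ) + 1) * δ - k * δ = δ := by ring
        rw [e] at h2
        push_cast
        linarith
    have h := step (N + 1) le_rfl
    push_cast at h
    rw [hδt] at h
    have e : ((N : ℝ) + 1) * (β * δ - C * δ ^ 2) = β * t - C * t ^ 2 * (1 / ((N : ℝ) + 1)) := by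
      rw [hδ]; field_simp
    rwa [e] at h
  have hlim : Tendsto (fun N : ℕ => β * t - C * t ^ 2 * (1 / ((N : ℝ) + 1))) atTop
      (𝓝 (β * t - C * t ^ 2 * 0)) :=
    (tendsto_one_div_add_atTop_nhds_zero_nat.const_mul _).const_sub _
  simpa using le_of_tendsto hlim (Eventually.of_forall key)

theorem exists_forall_nonneg_lower_bound {V B : ℝ → ℝ} {C : ℝ}
    (hK : ∀ᶠ p : ℝ × ℝ in 𝓝 (0, 0),
      V p.2 ≤ V p.1 + 3 * (p.2 - p.1) * B p.1 + C * (p.2 - p.1) ^ 2)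
    (hB : HasDerivAt B 0 0) {η : ℝ} (hη : 0 < η) :
    ∃ ρ > 0, ∀ t, 0 ≤ t → t < ρ → V 0 + 3 * t * B 0 - η * t ^ 2 ≤ V t := by
  have hB' : ∀ᶠ s in 𝓝 (0 : ℝ), |B s - B 0| ≤ η / 3 * |s| := by
    have := (hasDerivAt_iff_isLittleO.1 hB).def (show (0 : ℝ) < η / 3 by positivity)
    simpa using this
  obtain ⟨ρ₁, hρ₁, h1⟩ := Metric.eventually_nhds_iff.1 hK
  obtain ⟨ρ₂, hρ₂, h2⟩ := Metric.eventually_nhds_iff.1 hB'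
  refine ⟨min ρ₁ ρ₂, lt_min hρ₁ hρ₂, fun t ht0 ht => ?_⟩
  have := mul_le_sub_of_forall_increment (f := V) (β := 3 * B 0 - η * t) (C := C) ht0 ?_
  · linarith
  intro x y hx hxy hyt
  have hy : y < min ρ₁ ρ₂ := hyt.trans_lt ht
  have a1 := @h1 (y, x) (by
    rw [Prod.dist_eq, max_lt_iff, Real.dist_0_eq_abs, Real.dist_0_eq_abs, abs_of_nonneg hx,
      abs_of_nonneg (hx.trans hxy)]
    exact ⟨hy.trans_le (min_le_left _ _), hxy.trans_lt (hy.trans_le (min_le_left _ _))⟩)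
  have a2 := @h2 y (by
    rw [Real.dist_0_eq_abs, abs_of_nonneg (hx.trans hxy)]
    exact hy.trans_le (min_le_right _ _))
  rw [abs_of_nonneg (hx.trans hxy)] at a2
  have a3 := (abs_le.1 a2).1
  have a4 : B 0 - η / 3 * t ≤ B y := by
    have := mul_le_mul_of_nonneg_left hyt (show 0 ≤ η / 3 by positivity)
    linarith
  have a5 := mul_le_mul_of_nonneg_left a4 (show 0 ≤ 3 * (y - x) by linarith)
  simp only at a1
  nlinarith

theorem eventually_lower_bound {V B : ℝ → ℝ} {C : ℝ}
    (hK : ∀ᶠ p : ℝ × ℝ in 𝓝 (0, 0),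
      V p.2 ≤ V p.1 + 3 * (p.2 - p.1) * B p.1 + C * (p.2 - p.1) ^ 2)
    (hB : HasDerivAt B 0 0) {η : ℝ} (hη : 0 < η) :
    ∀ᶠ t in 𝓝 0, V 0 + 3 * t * B 0 - η * t ^ 2 ≤ V t := by
  obtain ⟨ρ₁, hρ₁, h1⟩ := exists_forall_nonneg_lower_bound hK hB hη
  have hneg : Tendsto (fun p : ℝ × ℝ => (-p.1, -p.2)) (𝓝 (0, 0)) (𝓝 (0, 0)) := by
    have : Continuous fun p : ℝ × ℝ => (-p.1, -p.2) := by fun_prop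
    simpa using this.tendsto (0, 0)
  have hB' : HasDerivAt (fun t => -B (-t)) 0 0 := by
    have : HasDerivAt B 0 (-0) := by simpa using hB
    have := (this.comp (0 : ℝ) (hasDerivAt_neg 0)).fun_neg
    rwa [zero_mul, neg_zero] at this
  obtain ⟨ρ₂, hρ₂, h2⟩ := exists_forall_nonneg_lower_bound (V := fun t => V (-t))
    (B := fun t => -B (-t)) (C := C) ((hneg.eventually hK).mono fun p hp => by
      simp only at hp ⊢
      linarith) hB' hη
  filter_upwards [Metric.ball_mem_nhds 0 (lt_min hρ₁ hρ₂)] with t ht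
  rw [Metric.mem_ball, Real.dist_0_eq_abs, lt_min_iff, abs_lt, abs_lt] at ht
  rcases le_total 0 t with h | h
  · exact h1 t h ht.1.2
  · have := h2 (-t) (by linarith) (by linarith [ht.2.1])
    simp only [neg_neg, neg_zero] at this
    linarith

theorem eventually_cubic_expansion {a : ℝ → ℝ} {h u : ℝ} (hh : 0 < h) (ha : ContinuousAt a 0) :
    ∃ C, ∀ᶠ p : ℝ × ℝ in 𝓝 (0, 0),
      ((h + p.2 * u) / (h + p.1 * u)) ^ 3 * ((h + p.1 * u) * a p.1) ≤
        (h + p.1 * u) * a p.1 + 3 * (p.2 - p.1) * (u * a p.1) + C * (p.2 - p.1) ^ 2 := by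
  let g : ℝ × ℝ → ℝ := fun p =>
    (3 * u ^ 2 / (h + p.1 * u) + (p.2 - p.1) * u ^ 3 / (h + p.1 * u) ^ 2) * a p.1
  have hg : ContinuousAt g (0, 0) := by
    have ha' : ContinuousAt (fun p : ℝ × ℝ => a p.1) (0, 0) :=
      ContinuousAt.comp (f := Prod.fst) (by exact ha) continuousAt_fst
    refine ContinuousAt.mul (ContinuousAt.add ?_ ?_) ha'
    · exact ContinuousAt.div (by fun_prop) (by fun_prop) (by simpa using hh.ne')
    · exact ContinuousAt.div (by fun_prop) (by fun_prop) (by simpa using hh.ne')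
  refine ⟨g (0, 0) + 1, ?_⟩
  have hpos : ∀ᶠ p : ℝ × ℝ in 𝓝 (0, 0), 0 < h + p.1 * u :=
    (show Continuous fun p : ℝ × ℝ => h + p.1 * u by fun_prop).continuousAt.eventually_const_lt
      (by simpa using hh)
  filter_upwards [hg.eventually_lt_const (lt_add_one _), hpos] with p hp hp1
  have e : ((h + p.2 * u) / (h + p.1 * u)) ^ 3 * ((h + p.1 * u) * a p.1) =
      (h + p.1 * u) * a p.1 + 3 * (p.2 - p.1) * (u * a p.1) + g p * (p.2 - p.1) ^ 2 := by
    obtain ⟨H, hH⟩ : ∃ H, H = h + p.1 * u := ⟨_, rfl⟩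
    have e : h + p.2 * u = H + (p.2 - p.1) * u := by rw [hH]; ring
    rw [← hH] at hp1
    simp only [g]
    rw [e, ← hH]
    field_simp
    ring
  rw [e]
  have := mul_le_mul_of_nonneg_right hp.le (sq_nonneg (p.2 - p.1))
  linarith

theorem eventually_lower_bound_of_sum {ι : Type*} [Fintype ι] {V : ℝ → ℝ} {a : ι → ℝ → ℝ}
    {h u : ι → ℝ} (hh : ∀ i, 0 < h i) (ha : ∀ i, HasDerivAt (a i) 0 0)
    (hV : ∀ᶠ t in 𝓝 0, V t = ∑ i, (h i + t * u i) * a i t)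
    (hVle : ∀ᶠ p : ℝ × ℝ in 𝓝 (0, 0), V p.2 ≤
      ∑ i, ((h i + p.2 * u i) / (h i + p.1 * u i)) ^ 3 * ((h i + p.1 * u i) * a i p.1))
    {η : ℝ} (hη : 0 < η) : ∀ᶠ t in 𝓝 0, V 0 - η * t ^ 2 ≤ V t := by
  choose C hC using fun i => eventually_cubic_expansion (u := u i) (hh i) (ha i).continuousAt
  have hB : HasDerivAt (fun t => ∑ i, u i * a i t) 0 0 := by
    simpa using HasDerivAt.fun_sum fun i (_ : i ∈ Finset.univ) => (ha i).const_mul (u i)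
  have hK : ∀ᶠ p : ℝ × ℝ in 𝓝 (0, 0), V p.2 ≤ V p.1 +
      3 * (p.2 - p.1) * (fun t => ∑ i, u i * a i t) p.1 + (∑ i, C i) * (p.2 - p.1) ^ 2 := by
    have hV1 : ∀ᶠ p : ℝ × ℝ in 𝓝 (0, 0), V p.1 = ∑ i, (h i + p.1 * u i) * a i p.1 :=
      (continuousAt_fst (p := ((0 : ℝ), (0 : ℝ)))).eventually hV
    filter_upwards [hVle, hV1, eventually_all.2 hC] with p h1 h2 h3
    rw [h2, Finset.mul_sum, Finset.sum_mul, ← Finset.sum_add_distrib, ← Finset.sum_add_distrib]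
    exact h1.trans (Finset.sum_le_sum fun i _ => h3 i)
  have hVd : HasDerivAt V (∑ i, u i * a i 0) 0 := by
    refine HasDerivAt.congr_of_eventuallyEq ?_ hV
    refine HasDerivAt.fun_sum fun i _ => ?_
    have h1 : HasDerivAt (fun t => h i + t * u i) (u i) 0 := by
      simpa using ((hasDerivAt_id (0 : ℝ)).mul_const (u i)).const_add (h i)
    simpa using h1.fun_mul (ha i)
  have hlow := fun (η : ℝ) (hη : 0 < η) => eventually_lower_bound hK hB hη
  have hB0 : ∑ i, u i * a i 0 = 0 := by
    have hmin : IsLocalMin (fun t => V t - 3 * t * (∑ i, u i * a i 0) + 1 * t ^ 2) 0 := by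
      filter_upwards [hlow 1 one_pos] with t ht
      linarith
    have hd : HasDerivAt (fun t => V t - 3 * t * (∑ i, u i * a i 0) + 1 * t ^ 2)
        ((∑ i, u i * a i 0) - 3 * (∑ i, u i * a i 0)) 0 := by
      have h1 := ((hasDerivAt_id (0 : ℝ)).const_mul 3).mul_const (∑ i, u i * a i 0)
      have h2 := (hasDerivAt_pow 2 (0 : ℝ)).const_mul 1
      simpa using (hVd.fun_sub h1).fun_add h2
    have := hmin.hasDerivAt_eq_zero hd
    linarith
  filter_upwards [hlow η hη] with t ht
  rw [hB0] at ht
  linarith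

theorem eventually_abs_sub_le_of_mul_le {V : ℝ → ℝ} (hV0 : 0 < V 0) (hVt : ∀ t, 0 ≤ V t)
    (hlow : ∀ η > 0, ∀ᶠ t in 𝓝 0, V 0 - η * t ^ 2 ≤ V t)
    (hmul : ∀ᶠ t in 𝓝 0, V t * V (-t) ≤ V 0 ^ 2) {η : ℝ} (hη : 0 < η) :
    ∀ᶠ t in 𝓝 0, |V t - V 0| ≤ η * t ^ 2 := by
  have hneg : Tendsto (fun t : ℝ => -t) (𝓝 0) (𝓝 0) := by
    simpa using (continuous_neg (G := ℝ)).tendsto 0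
  have hsmall : ∀ᶠ t : ℝ in 𝓝 0, η * t ^ 2 < V 0 :=
    (show Continuous fun t : ℝ => η * t ^ 2 by fun_prop).continuousAt.eventually_lt_const
      (by simpa using hV0)
  filter_upwards [hlow (η / 2) (by positivity), hneg.eventually (hlow (η / 2) (by positivity)),
    hmul, hsmall] with t h1 h2 h3 h4
  have ht : 0 ≤ η * t ^ 2 := by positivity
  rw [neg_sq] at h2
  rw [abs_le]
  constructor
  · linarith
  have h5 := mul_le_mul_of_nonneg_left h2 (hVt t)
  have h6 : 0 < V 0 - η / 2 * t ^ 2 := by linarith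
  have h7 : V t ≤ V 0 + η * t ^ 2 := by
    refine le_of_mul_le_mul_right ?_ h6
    nlinarith
  linarith

end Scalar

section Stability
open Set

theorem sub_mul_le_setIntegral_max {n : ℕ} {A : Set (EuclideanSpace ℝ (Fin n))} (hA : IsCompact A)
    {s : EuclideanSpace ℝ (Fin n) → ℝ} (hs : Continuous s) (c : ℝ) :
    ∫ x in A, max (s x - c) 0 =
      (∫ x in A, s x) - c * volume.real A + ∫ x in A, max (c - s x) 0 := by
  have hint : ∀ k : EuclideanSpace ℝ (Fin n) → ℝ, Continuous k → IntegrableOn k A := fun k hk =>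
    hk.continuousOn.integrableOn_compact hA
  have e : ∀ x, max (s x - c) 0 = s x - c + max (c - s x) 0 := by
    intro x
    rcases le_total (s x) c with h | h
    · rw [max_eq_right (by linarith), max_eq_left (by linarith)]; ring
    · rw [max_eq_left (by linarith), max_eq_right (by linarith)]; ring
  simp only [e]
  rw [integral_add (hint _ (by fun_prop)) (hint _ (by fun_prop)),
    integral_sub (hint _ hs) (hint _ continuous_const), setIntegral_const, smul_eq_mul, mul_comm c]

theorem mul_le_midpoint_sq {a b c : ℝ} (h : a + b = 2 * c) : a * b ≤ c ^ 2 := by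
  have : c = (a + b) / 2 := by linarith
  rw [this]
  nlinarith [sq_nonneg (a - b)]

theorem le_of_mul_le_sq {M d g : ℝ} (hd : 0 ≤ d) (hM : 8 * d ≤ M) (h0 : 0 < M - 4 * d)
    (h : (M - 4 * d + g) * (M - 4 * d) ≤ M ^ 2) : g ≤ 16 * d := by
  by_contra! hcon
  have h1 : (M + 12 * d) * (M - 4 * d) < (M - 4 * d + g) * (M - 4 * d) :=
    mul_lt_mul_of_pos_right (by linarith) h0
  nlinarith [mul_nonneg hd (sub_nonneg.2 hM), mul_nonneg hd hd]

/-- Quantitative stability of the first moment of an affine function under near equality of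
volumes in the Brunn–Minkowski inequality. -/
theorem first_moment_stability {n : ℕ} {A B C : Set (EuclideanSpace ℝ (Fin n))}
    (hA : IsCompact A) (hB : IsCompact B) (hC : IsCompact C)
    (hABC : ∀ x ∈ A, ∀ y ∈ B, (2⁻¹ : ℝ) • (x + y) ∈ C)
    {f g k : EuclideanSpace ℝ (Fin n) → ℝ} (hf : Continuous f) (hg : Continuous g)
    (hk : Continuous k) (hfgk : ∀ x y, f x + g y = 2 * k ((2⁻¹ : ℝ) • (x + y)))
    {S : ℝ} (hfA : ∀ x ∈ A, 0 ≤ f x ∧ f x ≤ S) (hgB : ∀ x ∈ B, 0 ≤ g x ∧ g x ≤ S)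
    (hkC : ∀ x ∈ C, 0 ≤ k x ∧ k x ≤ S) {ε : ℝ} (hV : 0 < volume.real C)
    (hVA : |volume.real A - volume.real C| ≤ ε) (hVB : |volume.real B - volume.real C| ≤ ε)
    (hεV : ε ≤ volume.real C) (hεM : 8 * S * ε ≤ ∫ x in C, k x) (hM : 0 < ∫ x in C, k x)
    {G : ℝ → ℝ} (hGA : ∀ c, 0 ≤ c → G c ≤ ∫ x in A, max (c - f x) 0)
    (hGB : ∀ c, 0 ≤ c → G c ≤ ∫ x in B, max (c - g x) 0) :
    G (|(∫ x in A, f x) - ∫ x in B, g x| / (2 * volume.real C)) ≤ 16 * S * ε := by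
  have hint : ∀ {D : Set (EuclideanSpace ℝ (Fin n))} {l : EuclideanSpace ℝ (Fin n) → ℝ},
      IsCompact D → Continuous l → IntegrableOn l D := fun hD hl =>
    hl.continuousOn.integrableOn_compact hD
  have hbd : ∀ {D : Set (EuclideanSpace ℝ (Fin n))} {l : EuclideanSpace ℝ (Fin n) → ℝ},
      IsCompact D → Continuous l → (∀ x ∈ D, 0 ≤ l x ∧ l x ≤ S) →
      0 ≤ ∫ x in D, l x ∧ ∫ x in D, l x ≤ S * volume.real D := by
    intro D l hD hl h
    refine ⟨setIntegral_nonneg hD.measurableSet fun x hx => (h x hx).1, ?_⟩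
    have := setIntegral_mono_on (hint hD hl) (hint hD (continuous_const (y := S)))
      hD.measurableSet fun x hx => (h x hx).2
    rwa [setIntegral_const, smul_eq_mul, mul_comm] at this
  have hsub : ∀ {D : Set (EuclideanSpace ℝ (Fin n))} {l : EuclideanSpace ℝ (Fin n) → ℝ} (c : ℝ),
      IsCompact D → Continuous l → ∫ x in D, (c - l x) = c * volume.real D - ∫ x in D, l x := by
    intro D l c hD hl
    rw [integral_sub (hint hD continuous_const) (hint hD hl), setIntegral_const, smul_eq_mul,
      mul_comm]
  obtain ⟨hMA0, hMA1⟩ := hbd hA hf hfA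
  obtain ⟨hMB0, hMB1⟩ := hbd hB hg hgB
  obtain ⟨hMC0, hMC1⟩ := hbd hC hk hkC
  have hmaxnn : ∀ {D : Set (EuclideanSpace ℝ (Fin n))} {l : EuclideanSpace ℝ (Fin n) → ℝ} (c : ℝ),
      0 ≤ ∫ x in D, max (c - l x) 0 := fun c => integral_nonneg fun x => le_max_right _ _
  have hposA := sub_mul_le_setIntegral_max hA hf
  have hposB := sub_mul_le_setIntegral_max hB hg
  obtain ⟨MA, hMA⟩ : ∃ r, r = ∫ x in A, f x := ⟨_, rfl⟩
  obtain ⟨MB, hMB⟩ : ∃ r, r = ∫ x in B, g x := ⟨_, rfl⟩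
  obtain ⟨M, hMe⟩ : ∃ r, r = ∫ x in C, k x := ⟨_, rfl⟩
  obtain ⟨VA, hVAe⟩ : ∃ r, r = volume.real A := ⟨_, rfl⟩
  obtain ⟨VB, hVBe⟩ : ∃ r, r = volume.real B := ⟨_, rfl⟩
  obtain ⟨V, hVe⟩ : ∃ r, r = volume.real C := ⟨_, rfl⟩
  obtain ⟨e, he⟩ : ∃ e, e = (MA - MB) / (2 * V) := ⟨_, rfl⟩
  rw [← hMA, ← hVAe] at hposA
  rw [← hMB, ← hVBe] at hposB
  rw [← hMA, ← hVAe] at hMA1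
  rw [← hMB, ← hVBe] at hMB1
  rw [← hMe, ← hVe] at hMC1
  rw [← hVAe, ← hVe] at hVA
  rw [← hVBe, ← hVe] at hVB
  rw [← hVe] at hV hεV
  rw [← hMe] at hεM hM
  rw [← hMA] at hMA0
  rw [← hMB] at hMB0
  rw [← hMA, ← hMB, ← hVe]
  have hε0 : 0 ≤ ε := (abs_nonneg _).trans hVA
  have hS0 : 0 < S := by
    by_contra! h
    nlinarith
  obtain ⟨hA1, hA2⟩ := abs_le.1 hVA
  obtain ⟨hB1, hB2⟩ := abs_le.1 hVB
  have heV : e * V = (MA - MB) / 2 := by rw [he]; field_simp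
  have heS : |e| ≤ S := by
    rw [he, abs_div, abs_of_pos (by positivity : 0 < 2 * V), div_le_iff₀ (by positivity), abs_le]
    constructor <;> nlinarith
  obtain ⟨he1, he2⟩ := abs_le.1 heS
  have prodbound : ∀ x y : ℝ, |x| ≤ 3 * S → |y| ≤ ε → -(3 * S * ε) ≤ x * y := by
    intro x y hx hy
    have := mul_le_mul hx hy (abs_nonneg _) (by positivity)
    rw [← abs_mul] at this
    exact (abs_le.1 this).1
  have prodbound' : ∀ x y : ℝ, |x| ≤ S → |y| ≤ ε → -(S * ε) ≤ x * y := by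
    intro x y hx hy
    have := mul_le_mul hx hy (abs_nonneg _) (by positivity)
    rw [← abs_mul] at this
    exact (abs_le.1 this).1
  have hmean : M - 3 * S * ε ≤ (MA + MB) / 2 := by
    have pl := prekopa_leindler_setIntegral hA hB hC (f := fun x => (2 * S + e) - f x)
      (g := fun x => (2 * S - e) - g x) (h := fun x => 2 * S - k x)
      (by fun_prop) (by fun_prop) (by fun_prop)
      (fun x hx => by linarith [(hfA x hx).2]) (fun x hx => by linarith [(hgB x hx).2])
      (fun x hx => by linarith [(hkC x hx).2]) hABC
      (fun x _ y _ => mul_le_midpoint_sq (by linarith [hfgk x y]))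
    rw [hsub _ hA hf, hsub _ hB hg, hsub _ hC hk, ← hMA, ← hMB, ← hMe, ← hVAe, ← hVBe, ← hVe] at pl
    have p1 := prodbound (2 * S + e) (VA - V) (abs_le.2 ⟨by linarith, by linarith⟩) hVA
    have p2 := prodbound (2 * S - e) (VB - V) (abs_le.2 ⟨by linarith, by linarith⟩) hVB
    by_contra! hcon
    have q1 : 2 * S * V - M < (2 * S + e) * VA - MA := by linarith
    have q2 : 2 * S * V - M < (2 * S - e) * VB - MB := by linarith
    have q3 : 0 ≤ 2 * S * V - M := by nlinarith
    nlinarith [mul_lt_mul'' q1 q2 q3 q3]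
  have pl := prekopa_leindler_setIntegral hA hB hC (f := fun x => max (f x - e) 0)
      (g := fun x => max (g x - -e) 0) (h := k)
      (by fun_prop) (by fun_prop) (by fun_prop)
      (fun x _ => le_max_right _ _) (fun x _ => le_max_right _ _)
      (fun x hx => (hkC x hx).1) hABC
      (fun x _ y _ => by
        rcases le_total (f x - e) 0 with h1 | h1
        · rw [max_eq_right h1, zero_mul]; positivity
        rcases le_total (g y - -e) 0 with h2 | h2
        · rw [max_eq_right h2, mul_zero]; positivity
        rw [max_eq_left h1, max_eq_left h2]
        exact mul_le_midpoint_sq (by linarith [hfgk x y]))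
  rw [hposA, hposB, ← hMe] at pl
  have p1 := prodbound' (-e) (VA - V) (by rwa [abs_neg]) hVA
  have p2 := prodbound' e (VB - V) heS hVB
  have r1 : M - 4 * S * ε ≤ MA - e * VA := by linarith
  have r2 : M - 4 * S * ε ≤ MB - -e * VB := by linarith
  have r3 : 0 < M - 4 * S * ε := by linarith
  have habs : |MA - MB| / (2 * V) = |e| := by
    rw [he, abs_div, abs_of_pos (by positivity : 0 < 2 * V)]
  rw [habs]
  have fin : ∀ P R : ℝ, 0 ≤ P → M - 4 * S * ε + G |e| ≤ P → M - 4 * S * ε ≤ R → P * R ≤ M ^ 2 →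
      G |e| ≤ 16 * S * ε := by
    intro P R hP h1 h2 h3
    have hSε : 0 ≤ S * ε := by positivity
    have h4 := (mul_le_mul h1 h2 r3.le hP).trans h3
    rw [mul_assoc] at h4 hεM r3 ⊢
    exact le_of_mul_le_sq hSε (by linarith) r3 h4
  rcases le_total 0 e with h | h
  · rw [abs_of_nonneg h] at fin ⊢
    have g1 := hGA e h
    have g2 := hmaxnn (D := B) (l := g) (-e)
    exact fin _ _ (by linarith [hmaxnn (D := A) (l := f) e]) (by linarith)
      (by linarith) pl
  · rw [abs_of_nonpos h] at fin ⊢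
    have g1 := hGB (-e) (by linarith)
    have g2 := hmaxnn (D := A) (l := f) e
    rw [mul_comm] at pl
    exact fin _ _ (by linarith [hmaxnn (D := B) (l := g) (-e)]) (by linarith)
      (by linarith) pl

end Stability

section Rigidity
open Set Filter Topology
open scoped Pointwise

variable {n : ℕ} {ν : Fin n → EuclideanSpace ℝ (Fin 3)} {h : Fin n → ℝ}

theorem mul_volume_le_setIntegral_of_subset {A D : Set (EuclideanSpace ℝ (Fin 3))}
    (hA : IsCompact A) (hD : MeasurableSet D) (hDA : D ⊆ A)
    {f : EuclideanSpace ℝ (Fin 3) → ℝ} (hf : Continuous f) (hf0 : ∀ x ∈ A, 0 ≤ f x) {c : ℝ}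
    (hc : ∀ x ∈ D, c ≤ f x) : c * volume.real D ≤ ∫ x in A, f x := by
  have hint : IntegrableOn f A := hf.continuousOn.integrableOn_compact hA
  have h1 := setIntegral_ge_of_const_le hD
    ((measure_mono hDA).trans_lt hA.measure_lt_top).ne hc (hint.mono_set hDA)
  rw [smul_eq_mul, mul_comm] at h1
  exact h1.trans (setIntegral_mono_set hint
    (ae_restrict_of_forall_mem hA.measurableSet hf0) hDA.eventuallyLE)

theorem sq_mul_le_setIntegral_max (hh : ∀ i, 0 < h i) (hc : IsCompact (polyQ ν h)) {i : Fin n}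
    {a : ℝ} (ha : volume.real (facePyramid ν h i) = h i * a) {c : ℝ} (hc0 : 0 ≤ c) :
    a / 4 * min c (h i) ^ 2 ≤ ∫ x in polyQ ν h, max (c - (h i - ⟪x, ν i⟫)) 0 := by
  have hi := hh i
  obtain ⟨m, hm⟩ : ∃ m, m = min c (h i) := ⟨_, rfl⟩
  have hm0 : 0 ≤ m := hm ▸ le_min hc0 hi.le
  have hmc : m ≤ c := hm ▸ min_le_left _ _
  have hmh : m ≤ h i := hm ▸ min_le_right _ _
  rw [← hm]
  have hslab := mul_volume_facePyramid_le_slab hh hc i (δ := m / (2 * h i)) (by positivity)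
    (by rw [div_lt_one (by positivity)]; linarith)
  have e : (1 - m / (2 * h i)) * h i = h i - m / 2 := by field_simp
  rw [e] at hslab
  have hmeas : MeasurableSet (polyQ ν h ∩ {x | h i - m / 2 ≤ ⟪x, ν i⟫}) :=
    ((isClosed_polyQ ν h).inter (isClosed_le (by fun_prop) (by fun_prop))).measurableSet
  have key := mul_volume_le_setIntegral_of_subset hc hmeas inter_subset_left
    (f := fun x => max (c - (h i - ⟪x, ν i⟫)) 0) (by fun_prop) (fun x _ => le_max_right _ _)
    (c := m / 2) (fun x hx => le_max_of_le_left (by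
      have : h i - m / 2 ≤ ⟪x, ν i⟫ := hx.2
      linarith))
  refine le_trans (le_of_eq_of_le ?_ (mul_le_mul_of_nonneg_left hslab (by positivity))) key
  rw [ha]
  field_simp
  norm_num
  ring

theorem setIntegral_support_gap_pos (hh : ∀ i, 0 < h i) (hc : IsCompact (polyQ ν h))
    (hV : 0 < volume.real (polyQ ν h)) (i : Fin n) :
    0 < ∫ x in polyQ ν h, (h i - ⟪x, ν i⟫) := by
  have hsub : (2⁻¹ : ℝ) • polyQ ν h ⊆ polyQ ν h := by
    rintro _ ⟨x, hx, rfl⟩ j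
    simp only [inner_smul_left, conj_trivial]
    have := hx j
    linarith [hh j]
  have h1 := mul_volume_le_setIntegral_of_subset hc (hc.smul (2⁻¹ : ℝ)).measurableSet hsub
    (f := fun x => h i - ⟪x, ν i⟫) (by fun_prop) (fun x hx => sub_nonneg.2 (hx i))
    (c := h i / 2) (by
      rintro _ ⟨x, hx, rfl⟩
      simp only [inner_smul_left, conj_trivial]
      have := hx i
      linarith [hh i])
  refine lt_of_lt_of_le (mul_pos (half_pos (hh i)) ?_) h1
  rw [measureReal_def, Measure.addHaar_smul_of_nonneg _ (by positivity), ENNReal.toReal_mul,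
    ENNReal.toReal_ofReal (by positivity)]
  exact mul_pos (by positivity) hV

theorem eventually_half_lt_lt_two_mul (hh : ∀ i, 0 < h i) (u : Fin n → ℝ) :
    ∀ᶠ t : ℝ in 𝓝 0, ∀ i, h i / 2 < h i + t * u i ∧ h i + t * u i < 2 * h i := by
  refine eventually_all.2 fun i => ?_
  have hcont : ContinuousAt (fun t : ℝ => h i + t * u i) 0 := by fun_prop
  have := hh i
  exact (hcont.eventually_const_lt (by simpa using by linarith)).and
    (hcont.eventually_lt_const (by simpa using by linarith))

theorem volume_mul_volume_le_sq {h₁ h₂ : Fin n → ℝ} (hc : IsCompact (polyQ ν h))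
    (hc₁ : IsCompact (polyQ ν h₁)) (hc₂ : IsCompact (polyQ ν h₂))
    (hmid : ∀ i, h₁ i + h₂ i = 2 * h i) :
    volume.real (polyQ ν h₁) * volume.real (polyQ ν h₂) ≤ volume.real (polyQ ν h) ^ 2 := by
  have := prekopa_leindler_setIntegral hc₁ hc₂ hc (f := fun _ => 1) (g := fun _ => 1)
    (h := fun _ => 1) continuous_const continuous_const continuous_const
    (fun _ _ => zero_le_one) (fun _ _ => zero_le_one) (fun _ _ => zero_le_one)
    (fun x hx y hy => midpoint_mem_polyQ hmid hx hy) (fun _ _ _ _ => by norm_num)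
  simpa using this

theorem tendsto_neg_nhds_zero : Tendsto (fun t : ℝ => -t) (𝓝 0) (𝓝 0) := by
  simpa using (continuous_neg (G := ℝ)).tendsto 0

theorem le_of_min_sq_le {a b r : ℝ} (hb : 0 ≤ b) (hbr : b < r) (h : min a r ^ 2 ≤ b ^ 2) :
    a ≤ b := by
  have := abs_le_of_sq_le_sq' h hb
  rcases min_le_iff.1 this.2 with h1 | h1
  · exact h1
  · linarith

theorem eventually_first_moment_sub_le (hh : ∀ i, 0 < h i) (hc : IsCompact (polyQ ν h))
    (u : Fin n → ℝ) (i : Fin n) {a : ℝ → ℝ} (ha : ContinuousAt a 0) (ha0 : 0 < a 0)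
    (hpyr : ∀ᶠ t : ℝ in 𝓝 0,
      volume.real (facePyramid ν (h + t • u) i) = (h i + t * u i) * a t)
    (hV : 0 < volume.real (polyQ ν h))
    (hVol : ∀ η > 0, ∀ᶠ t : ℝ in 𝓝 0,
      |volume.real (polyQ ν (h + t • u)) - volume.real (polyQ ν h)| ≤ η * t ^ 2)
    {η : ℝ} (hη : 0 < η) :
    ∀ᶠ t : ℝ in 𝓝 0, |(∫ x in polyQ ν (h + t • u), (h i + t * u i - ⟪x, ν i⟫)) -
      ∫ x in polyQ ν (h + (-t) • u), (h i + (-t) * u i - ⟪x, ν i⟫)| ≤ η * |t| := by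
  have hi := hh i
  have hc2 : IsCompact (polyQ ν fun j => 2 * h j) :=
    isCompact_polyQ_of_le hc two_pos fun j => le_rfl
  obtain ⟨R, hR⟩ := (hc2.image (f := fun x => |⟪x, ν i⟫|) (by fun_prop)).bddAbove
  have hR' : ∀ x ∈ polyQ ν (fun j => 2 * h j), -|R| ≤ ⟪x, ν i⟫ := fun x hx => by
    have h1 : |⟪x, ν i⟫| ≤ R := hR (mem_image_of_mem _ hx)
    linarith [neg_abs_le ⟪x, ν i⟫, le_abs_self R]
  obtain ⟨S, hS⟩ : ∃ S, S = 2 * h i + |R| := ⟨_, rfl⟩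
  have hS0 : 0 < S := by rw [hS]; positivity
  have hM := setIntegral_support_gap_pos hh hc hV i
  obtain ⟨V, hVe⟩ : ∃ V, V = volume.real (polyQ ν h) := ⟨_, rfl⟩
  rw [← hVe] at hV hVol
  obtain ⟨θ, hθ⟩ : ∃ θ, θ = a 0 / 8 * (η / (2 * V)) ^ 2 / (16 * S) := ⟨_, rfl⟩
  have hθ0 : 0 < θ := by rw [hθ]; positivity
  let P : ℝ → Prop := fun t => (∀ j, h j / 2 < h j + t * u j ∧ h j + t * u j < 2 * h j) ∧
    a 0 / 2 < a t ∧ volume.real (facePyramid ν (h + t • u) i) = (h i + t * u i) * a t ∧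
    |volume.real (polyQ ν (h + t • u)) - V| ≤ θ * t ^ 2
  have hP : ∀ᶠ t in 𝓝 0, P t := by
    filter_upwards [eventually_half_lt_lt_two_mul hh u, ha.eventually_const_lt (half_lt_self ha0),
      hpyr, hVol θ hθ0] with t h1 h2 h3 h4
    exact ⟨h1, h2, h3, h4⟩
  have hsmall1 : ∀ᶠ t : ℝ in 𝓝 0, θ * t ^ 2 < V :=
    (show ContinuousAt (fun t : ℝ => θ * t ^ 2) 0 by fun_prop).eventually_lt_const
      (by simpa using hV)
  have hsmall2 : ∀ᶠ t : ℝ in 𝓝 0, 8 * S * (θ * t ^ 2) < ∫ x in polyQ ν h, (h i - ⟪x, ν i⟫) :=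
    (show ContinuousAt (fun t : ℝ => 8 * S * (θ * t ^ 2)) 0 by fun_prop).eventually_lt_const
      (by simpa using hM)
  have hsmall3 : ∀ᶠ t : ℝ in 𝓝 0, η / (2 * V) * |t| < h i / 2 :=
    (show ContinuousAt (fun t : ℝ => η / (2 * V) * |t|) 0 by fun_prop).eventually_lt_const
      (by simpa using hi)
  have hbody : ∀ t, P t → IsCompact (polyQ ν (h + t • u)) ∧
      (∀ x ∈ polyQ ν (h + t • u), 0 ≤ h i + t * u i - ⟪x, ν i⟫ ∧
        h i + t * u i - ⟪x, ν i⟫ ≤ S) ∧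
      ∀ c, 0 ≤ c → a 0 / 8 * min c (h i / 2) ^ 2 ≤
        ∫ x in polyQ ν (h + t • u), max (c - (h i + t * u i - ⟪x, ν i⟫)) 0 := by
    rintro t ⟨h1, h2, h3, -⟩
    have hct : IsCompact (polyQ ν (h + t • u)) :=
      isCompact_polyQ_of_le hc two_pos fun j => (h1 j).2.le
    refine ⟨hct, fun x hx => ⟨sub_nonneg.2 (hx i), ?_⟩, fun c hc0 => ?_⟩
    · have := hR' x fun j => (hx j).trans (h1 j).2.le
      rw [hS]
      linarith [(h1 i).2]
    · have hht : ∀ j, 0 < (h + t • u) j := fun j => lt_trans (half_pos (hh j)) (h1 j).1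
      refine le_trans ?_ (sq_mul_le_setIntegral_max hht hct h3 hc0)
      have hmin0 : 0 ≤ min c (h i / 2) := le_min hc0 (half_pos hi).le
      refine mul_le_mul (by linarith) (pow_le_pow_left₀ hmin0 ?_ 2) (by positivity) (by linarith)
      exact min_le_min_left _ (h1 i).1.le
  filter_upwards [hP, tendsto_neg_nhds_zero.eventually hP, hsmall1, hsmall2, hsmall3]
    with t hp hn hs1 hs2 hs3
  obtain ⟨p1, p2, p3⟩ := hbody t hp
  obtain ⟨n1, n2, n3⟩ := hbody (-t) hn
  have hp4 := hp.2.2.2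
  have hn4 := hn.2.2.2
  rw [neg_sq] at hn4
  have key := first_moment_stability p1 n1 hc
    (fun x hx y hy => midpoint_mem_polyQ (h₁ := h + t • u) (h₂ := h + (-t) • u) (h := h)
      (fun j => by simp only [Pi.add_apply, Pi.smul_apply, smul_eq_mul]; ring) hx hy)
    (f := fun x => h i + t * u i - ⟪x, ν i⟫) (g := fun x => h i + (-t) * u i - ⟪x, ν i⟫)
    (k := fun x => h i - ⟪x, ν i⟫) (by fun_prop) (by fun_prop) (by fun_prop)
    (fun x y => by
      rw [inner_smul_left, inner_add_left, conj_trivial]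
      ring)
    p2 n2 (fun x hx => ⟨sub_nonneg.2 (hx i), by
      have := hR' x fun j => (hx j).trans (by linarith [hh j])
      rw [hS]
      linarith⟩)
    (ε := θ * t ^ 2) (hVe ▸ hV) (hVe ▸ hp4) (hVe ▸ hn4) (hVe ▸ hs1.le) hs2.le hM
    (G := fun c => a 0 / 8 * min c (h i / 2) ^ 2) p3 n3
  rw [← hVe] at key
  have e : 16 * S * (θ * t ^ 2) = a 0 / 8 * (η / (2 * V) * |t|) ^ 2 := by
    rw [hθ, mul_pow, sq_abs]
    field_simp
  rw [e] at key
  have key2 := le_of_min_sq_le (by positivity) hs3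
    (le_of_mul_le_mul_left key (by positivity))
  rw [div_le_iff₀ (by positivity)] at key2
  refine key2.trans_eq ?_
  field_simp

theorem exists_forall_eq_inner_of_tendsto {u : Fin n → ℝ} {q : ℝ → EuclideanSpace ℝ (Fin 3)}
    (hq : ∀ i, Tendsto (fun t => ⟪q t, ν i⟫) (𝓝[>] 0) (𝓝 (u i))) :
    ∃ a : EuclideanSpace ℝ (Fin 3), ∀ i, u i = ⟪a, ν i⟫ := by
  let L : EuclideanSpace ℝ (Fin 3) →ₗ[ℝ] Fin n → ℝ :=
    { toFun := fun a i => ⟪a, ν i⟫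
      map_add' := fun a b => funext fun i => inner_add_left _ _ _
      map_smul' := fun c a => funext fun i => by simp [inner_smul_left] }
  have hcl : IsClosed (LinearMap.range L : Set (Fin n → ℝ)) :=
    Submodule.closed_of_finiteDimensional _
  have hmem : u ∈ (LinearMap.range L : Set (Fin n → ℝ)) :=
    hcl.mem_of_tendsto (f := fun t => L (q t)) (tendsto_pi_nhds.2 hq)
      (Eventually.of_forall fun t => ⟨q t, rfl⟩)
  obtain ⟨a, ha⟩ := hmem
  exact ⟨a, fun i => (congrFun ha i).symm⟩

theorem setIntegral_support_gap_eq {A : Set (EuclideanSpace ℝ (Fin 3))} (hA : IsCompact A)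
    (c : ℝ) (v : EuclideanSpace ℝ (Fin 3)) :
    ∫ x in A, (c - ⟪x, v⟫) = c * volume.real A - ⟪∫ x in A, x, v⟫ := by
  have hint : IntegrableOn (fun x : EuclideanSpace ℝ (Fin 3) => x) A :=
    continuous_id.continuousOn.integrableOn_compact hA
  have e := integral_inner (𝕜 := ℝ) hint v
  simp only [real_inner_comm _ v] at e
  rw [integral_sub (by exact continuous_const.continuousOn.integrableOn_compact hA)
    (by exact (by fun_prop : Continuous fun x : EuclideanSpace ℝ (Fin 3) =>
      ⟪x, v⟫).continuousOn.integrableOn_compact hA),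
    setIntegral_const, smul_eq_mul, mul_comm, e]

theorem exists_forall_eq_inner_of_pos (hunit : ∀ i, ‖ν i‖ = 1) (hdist : Function.Injective ν)
    (hh : ∀ i, 0 < h i) (hc : IsCompact (polyQ ν h)) (hpos : ∀ i, 0 < faceArea ν h i)
    {u : Fin n → ℝ} (hder : ∀ i, HasDerivAt (fun t : ℝ => faceArea ν (h + t • u) i) 0 0) :
    ∃ a : EuclideanSpace ℝ (Fin 3), ∀ i, u i = ⟪a, ν i⟫ := by
  obtain ⟨κ, hκ, hpyr⟩ := exists_volume_facePyramid_eq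
  obtain ⟨a, ha⟩ : ∃ a : Fin n → ℝ → ℝ, a = fun i t => κ * faceArea ν (h + t • u) i := ⟨_, rfl⟩
  have had : ∀ i, HasDerivAt (a i) 0 0 := fun i => by
    rw [ha]
    simpa using (hder i).const_mul κ
  have ha0 : ∀ i, 0 < a i 0 := fun i => by
    rw [ha]
    simpa using mul_pos hκ (hpos i)
  have hnice : ∀ᶠ t : ℝ in 𝓝 0, (∀ i, 0 < (h + t • u) i) ∧ IsCompact (polyQ ν (h + t • u)) := by
    filter_upwards [eventually_half_lt_lt_two_mul hh u] with t ht
    exact ⟨fun i => lt_trans (half_pos (hh i)) (ht i).1,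
      isCompact_polyQ_of_le hc two_pos fun i => (ht i).2.le⟩
  have hpyr' : ∀ᶠ t : ℝ in 𝓝 0, ∀ i,
      volume.real (facePyramid ν (h + t • u) i) = (h i + t * u i) * a i t := by
    filter_upwards [hnice] with t ht i
    rw [ha]
    exact hpyr hunit ht.1 i
  obtain ⟨V, hV⟩ : ∃ V : ℝ → ℝ, V = fun t => volume.real (polyQ ν (h + t • u)) := ⟨_, rfl⟩
  have hVzero : V 0 = volume.real (polyQ ν h) := by simp [hV]
  have hsum : ∀ᶠ t in 𝓝 0, V t = ∑ i, (h i + t * u i) * a i t := by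
    filter_upwards [hnice, hpyr'] with t ht hp
    rw [hV]
    simp only
    rw [volume_polyQ_eq_sum hunit hdist ht.1 ht.2]
    exact Finset.sum_congr rfl fun i _ => hp i
  have hV0 : 0 < V 0 := by
    obtain ⟨i, -⟩ := exists_maximal_gauge hh hc 0
    rw [hsum.self_of_nhds]
    simp only [zero_mul, add_zero]
    exact Finset.sum_pos (fun i _ => mul_pos (hh i) (ha0 i)) ⟨i, Finset.mem_univ i⟩
  have hVle : ∀ᶠ p : ℝ × ℝ in 𝓝 (0, 0), V p.2 ≤
      ∑ i, ((h i + p.2 * u i) / (h i + p.1 * u i)) ^ 3 * ((h i + p.1 * u i) * a i p.1) := by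
    have hfst : Tendsto (Prod.fst : ℝ × ℝ → ℝ) (𝓝 (0, 0)) (𝓝 0) := continuousAt_fst
    have hsnd : Tendsto (Prod.snd : ℝ × ℝ → ℝ) (𝓝 (0, 0)) (𝓝 0) := continuousAt_snd
    filter_upwards [hfst.eventually hnice, hsnd.eventually hnice, hfst.eventually hpyr']
      with p h1 h2 h3
    rw [hV]
    refine (volume_polyQ_le_sum h1.1 h1.2 h2.1).trans_eq (Finset.sum_congr rfl fun i _ => ?_)
    rw [h3 i]
    simp only [Pi.add_apply, Pi.smul_apply, smul_eq_mul]
  have hmul : ∀ᶠ t in 𝓝 0, V t * V (-t) ≤ V 0 ^ 2 := by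
    filter_upwards [hnice, tendsto_neg_nhds_zero.eventually hnice] with t h1 h2
    rw [hVzero, hV]
    refine volume_mul_volume_le_sq hc h1.2 h2.2 fun i => ?_
    simp only [Pi.add_apply, Pi.smul_apply, smul_eq_mul]
    ring
  have hVol : ∀ η > 0, ∀ᶠ t in 𝓝 0, |V t - V 0| ≤ η * t ^ 2 := fun η hη =>
    eventually_abs_sub_le_of_mul_le hV0 (fun t => by rw [hV]; exact measureReal_nonneg)
      (fun η hη => eventually_lower_bound_of_sum hh had hsum hVle hη) hmul hη
  obtain ⟨I, hI⟩ : ∃ I : ℝ → EuclideanSpace ℝ (Fin 3),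
    I = fun t => ∫ x in polyQ ν (h + t • u), x := ⟨_, rfl⟩
  refine exists_forall_eq_inner_of_tendsto (q := fun t => (2 * t * V 0)⁻¹ • (I t - I (-t)))
    fun i => ?_
  rw [Metric.tendsto_nhds]
  intro η hη
  obtain ⟨θ, hθ⟩ : ∃ θ, θ = V 0 * η / 2 := ⟨_, rfl⟩
  have hθ0 : 0 < θ := by rw [hθ]; positivity
  have hmom := eventually_first_moment_sub_le hh hc u i (had i).continuousAt (ha0 i)
    (hpyr'.mono fun t ht => ht i) (hVzero ▸ hV0) (by rw [hVzero, hV] at hVol; exact hVol) hθ0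
  have hi := hh i
  have hsmall : ∀ᶠ t : ℝ in 𝓝 0, 2 * (h i + |t| * |u i|) * (1 * |t|) < θ :=
    (show ContinuousAt (fun t : ℝ => 2 * (h i + |t| * |u i|) * (1 * |t|)) 0 by
      fun_prop).eventually_lt_const (by simpa using hθ0)
  have hneg := tendsto_neg_nhds_zero
  filter_upwards [self_mem_nhdsWithin, nhdsWithin_le_nhds hmom, nhdsWithin_le_nhds hnice,
    nhdsWithin_le_nhds (hneg.eventually hnice), nhdsWithin_le_nhds (hVol 1 one_pos),
    nhdsWithin_le_nhds (hneg.eventually (hVol 1 one_pos)), nhdsWithin_le_nhds hsmall]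
    with t ht h1 h2 h3 h4 h5 h6
  have ht0 : 0 < t := ht
  rw [setIntegral_support_gap_eq h2.2, setIntegral_support_gap_eq h3.2, abs_of_pos ht0] at h1
  rw [abs_of_pos ht0] at h6
  rw [neg_sq] at h5
  have hIt : ∀ s, ∫ x in polyQ ν (h + s • u), x = I s := fun s => by rw [hI]
  have hVt : ∀ s, volume.real (polyQ ν (h + s • u)) = V s := fun s => by rw [hV]
  simp only [hIt, hVt] at h1
  rw [Real.dist_eq, inner_smul_left, inner_sub_left, conj_trivial]
  have e : (2 * t * V 0)⁻¹ * (⟪I t, ν i⟫ - ⟪I (-t), ν i⟫) - u i =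
      ((⟪I t, ν i⟫ - ⟪I (-t), ν i⟫) - 2 * t * V 0 * u i) / (2 * t * V 0) := by
    field_simp
  rw [e, abs_div, abs_of_pos (by positivity : 0 < 2 * t * V 0), div_lt_iff₀ (by positivity)]
  have e2 : (⟪I t, ν i⟫ - ⟪I (-t), ν i⟫) - 2 * t * V 0 * u i =
      (h i + t * u i) * (V t - V 0) + (-(h i - t * u i)) * (V (-t) - V 0) -
      ((h i + t * u i) * V t - ⟪I t, ν i⟫ - ((h i + -t * u i) * V (-t) - ⟪I (-t), ν i⟫)) := by
    ring
  have hb : ∀ x y : ℝ, |x| ≤ h i + t * |u i| → |y| ≤ 1 * t ^ 2 →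
      |x * y| ≤ (h i + t * |u i|) * (1 * t ^ 2) := fun x y hx hy => by
    rw [abs_mul]
    exact mul_le_mul hx hy (abs_nonneg _) (by positivity)
  have hu1 := mul_le_mul_of_nonneg_left (le_abs_self (u i)) ht0.le
  have hu2 := mul_le_mul_of_nonneg_left (neg_abs_le (u i)) ht0.le
  have b1 := hb (h i + t * u i) _ (abs_le.2 ⟨by linarith, by linarith⟩) h4
  have b2 := hb (-(h i - t * u i)) _ (abs_le.2 ⟨by linarith, by linarith⟩) h5
  rw [e2]
  refine ((abs_sub _ _).trans (add_le_add (abs_add_le _ _) h1)).trans_lt ?_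
  have h7 := mul_lt_mul_of_pos_right h6 ht0
  have e3 : η * (2 * t * V 0) = θ * t + θ * t + 2 * (θ * t) := by rw [hθ]; ring
  have h8 : 0 < θ * t := by positivity
  rw [e3]
  linarith

theorem polyQ_sub_inner (ν : Fin n → EuclideanSpace ℝ (Fin 3)) (h : Fin n → ℝ)
    (p : EuclideanSpace ℝ (Fin 3)) :
    polyQ ν (fun j => h j - ⟪p, ν j⟫) = (fun x => x + p) ⁻¹' polyQ ν h := by
  ext x
  simp only [polyQ, mem_preimage, mem_ofPred_eq, inner_add_left, le_sub_iff_add_le]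

theorem faceArea_sub_inner (ν : Fin n → EuclideanSpace ℝ (Fin 3)) (h : Fin n → ℝ)
    (p : EuclideanSpace ℝ (Fin 3)) (i : Fin n) :
    faceArea ν (fun j => h j - ⟪p, ν j⟫) i = faceArea ν h i := by
  have e : polyQ ν (fun j => h j - ⟪p, ν j⟫) ∩ {x | ⟪x, ν i⟫ = h i - ⟪p, ν i⟫} =
      (fun x => x + p) ⁻¹' (polyQ ν h ∩ {x | ⟪x, ν i⟫ = h i}) := by
    rw [polyQ_sub_inner, preimage_inter]
    congr 1
    ext x
    simp only [mem_preimage, mem_ofPred_eq, inner_add_left, eq_sub_iff_add_eq]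
  rw [faceArea, faceArea, e]
  exact congrArg ENNReal.toReal ((IsometryEquiv.addRight p).hausdorffMeasure_preimage 2 _)

theorem inner_lt_of_mem_interior (hunit : ∀ i, ‖ν i‖ = 1) {p : EuclideanSpace ℝ (Fin 3)}
    (hp : p ∈ interior (polyQ ν h)) (i : Fin n) : ⟪p, ν i⟫ < h i := by
  have hcont : Tendsto (fun t : ℝ => p + t • ν i) (𝓝[>] 0) (𝓝 p) := by
    have : Tendsto (fun t : ℝ => p + t • ν i) (𝓝 0) (𝓝 (p + (0 : ℝ) • ν i)) :=
      (by fun_prop : Continuous fun t : ℝ => p + t • ν i).tendsto 0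
    rw [zero_smul, add_zero] at this
    exact this.mono_left nhdsWithin_le_nhds
  obtain ⟨t, ht, ht0⟩ := ((hcont.eventually (mem_interior_iff_mem_nhds.1 hp)).and
    self_mem_nhdsWithin).exists
  have h1 : ⟪p + t • ν i, ν i⟫ ≤ h i := ht i
  rw [inner_add_left, inner_smul_left, real_inner_self_eq_norm_sq, hunit, conj_trivial] at h1
  have h2 : 0 < t := ht0
  linarith

end Rigidity

/-- Gauss infinitesimal rigidity of convex polyhedra: if all face areas are stationary
along a linear family of polyhedra, the deformation is an infinitesimal translation. -/
theorem gauss_infinitesimal_rigidity {n : ℕ} (ν : Fin n → EuclideanSpace ℝ (Fin 3))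
    (hunit : ∀ i, ‖ν i‖ = 1) (hdist : Function.Injective ν)
    (h0 : Fin n → ℝ) (hcpt : IsCompact (polyQ ν h0))
    (hint : (interior (polyQ ν h0)).Nonempty)
    (hpos : ∀ i, 0 < faceArea ν h0 i)
    (u : Fin n → ℝ)
    (hder : ∀ i, HasDerivAt (fun t : ℝ => faceArea ν (h0 + t • u) i) 0 0) :
    ∃ a : EuclideanSpace ℝ (Fin 3), ∀ i, u i = ⟪a, ν i⟫ := by
  obtain ⟨p, hp⟩ := hint
  refine exists_forall_eq_inner_of_pos (h := fun j => h0 j - ⟪p, ν j⟫) hunit hdist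
    (fun i => sub_pos.2 (inner_lt_of_mem_interior hunit hp i)) ?_
    (fun i => (faceArea_sub_inner ν h0 p i).symm ▸ hpos i) fun i => ?_
  · rw [polyQ_sub_inner]
    exact (Homeomorph.addRight p).isCompact_preimage.2 hcpt
  · refine (hder i).congr_of_eventuallyEq (Filter.Eventually.of_forall fun t => ?_)
    simp only
    rw [← faceArea_sub_inner ν (h0 + t • u) p i]
    congr 1
    funext j
    simp only [Pi.add_apply, Pi.smul_apply, smul_eq_mul]
    ring
end

section
/- Let a, b, p, q : ℝ → ℝ be functions differentiable at t₀ such that in a neighborhood of t₀ one has a(t) > 0, b(t) > 0, the function t ↦ arctan(p(t)/a(t)) + arctan(q(t)/b(t)) is constant, and a(t)² + p(t)² = b(t)² + q(t)². Then a′(t₀)·p(t₀) + b′(t₀)·q(t₀) = a(t₀)·p′(t₀) + b(t₀)·q′(t₀). -/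
/-- The derivative of the polar angle `arctan (p / a)` of a moving point `(a, p)`. -/
theorem HasDerivAt.arctan_div {a p : ℝ → ℝ} {t a' p' : ℝ} (ha : HasDerivAt a a' t)
    (hp : HasDerivAt p p' t) (h : a t ≠ 0) :
    HasDerivAt (fun s => Real.arctan (p s / a s))
      ((p' * a t - p t * a') / (a t ^ 2 + p t ^ 2)) t := by
  convert (hp.fun_div ha h).arctan using 1
  field_simp

/-- The basic lemma on the quadrilateral `0 qᵢ q_{ij} qⱼ`: if `arctan(p/a) + arctan(q/b)`
is constant near `t₀`, `a, b > 0` near `t₀`, and `a² + p² = b² + q²` near `t₀`, then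
`a′p + b′q = ap′ + bq′` at `t₀`. -/
theorem quadrilateral_basic_lemma (a b p q : ℝ → ℝ) (t₀ a' b' p' q' : ℝ)
    (ha : HasDerivAt a a' t₀) (hb : HasDerivAt b b' t₀)
    (hp : HasDerivAt p p' t₀) (hq : HasDerivAt q q' t₀)
    (hpos : ∀ᶠ t in nhds t₀, 0 < a t ∧ 0 < b t)
    (hconst : ∃ φ : ℝ, ∀ᶠ t in nhds t₀,
      Real.arctan (p t / a t) + Real.arctan (q t / b t) = φ)
    (hdist : ∀ᶠ t in nhds t₀, a t ^ 2 + p t ^ 2 = b t ^ 2 + q t ^ 2) :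
    a' * p t₀ + b' * q t₀ = a t₀ * p' + b t₀ * q' := by
  obtain ⟨φ, hφ⟩ := hconst
  obtain ⟨ha₀, hb₀⟩ := hpos.self_of_nhds
  have hsum := (ha.arctan_div hp ha₀.ne').fun_add (hb.arctan_div hq hb₀.ne')
  have hzero := hsum.unique ((hasDerivAt_const t₀ φ).congr_of_eventuallyEq hφ)
  have hne : b t₀ ^ 2 + q t₀ ^ 2 ≠ 0 := by positivity
  rw [hdist.self_of_nhds, ← add_div, div_eq_zero_iff] at hzero
  linarith [hzero.resolve_right hne]
end

section
/- Let m ≥ 3 and let N be the m×m real matrix indexed by ZMod m with diagonal entries N_{jj} = −2cos(2π/m), entries N_{jk} = 1 whenever k = j+1 or k = j−1 (mod m), and all other entries 0. Then the characteristic polynomial of N equals ∏_{k=1}^{m} (X − (2cos(2πk/m) − 2cos(2π/m))); in particular N has exactly one positive eigenvalue (namely 2 − 2cos(2π/m), for k = m), the eigenvalue 0 with multiplicity exactly two (k = 1 and k = m−1), and all remaining eigenvalues negative. -/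
open Polynomial

/-- A matrix which is diagonalized by an invertible matrix `F` has the expected characteristic
polynomial. -/
theorem charpoly_eq_prod_of_mul_eq_mul_diagonal {n R : Type*} [Fintype n] [DecidableEq n]
    [CommRing R] {A F : Matrix n n R} {d : n → R} (hF : IsUnit F)
    (h : A * F = F * Matrix.diagonal d) :
    A.charpoly = ∏ i, (X - C (d i)) := by
  obtain ⟨U, rfl⟩ := hF
  have hA : A = U.val * Matrix.diagonal d * U⁻¹.val := by
    rw [← h, mul_assoc, Units.mul_inv, mul_one]
  rw [hA, Matrix.coe_units_inv, Matrix.charpoly_units_conj, Matrix.charpoly_diagonal]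

/-- The discrete Fourier transform matrix is invertible. -/
theorem isUnit_of_stdAddChar (m : ℕ) [NeZero m] :
    IsUnit (Matrix.of fun j k : ZMod m => ZMod.stdAddChar (j * k)) := by
  have hm : (m : ℂ) ≠ 0 := Nat.cast_ne_zero.mpr (NeZero.ne m)
  refine IsUnit.of_mul_eq_one
    ((m : ℂ)⁻¹ • Matrix.of fun j k : ZMod m => ZMod.stdAddChar (-(j * k))) ?_
  ext i j
  have key : ∀ l : ZMod m, ZMod.stdAddChar (i * l) * ZMod.stdAddChar (-(l * j)) =
      ZMod.stdAddChar (l * (i - j)) := fun l => by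
    rw [← AddChar.map_add_eq_mul]
    ring_nf
  rw [Matrix.mul_smul, Matrix.smul_apply, Matrix.mul_apply]
  simp only [Matrix.of_apply, key]
  rw [AddChar.sum_mulShift _ (ZMod.isPrimitive_stdAddChar m), ZMod.card, Matrix.one_apply]
  simp only [sub_eq_zero]
  split_ifs <;> simp [hm]

theorem stdAddChar_add_stdAddChar_neg {m : ℕ} [NeZero m] (k : ZMod m) :
    ZMod.stdAddChar k + ZMod.stdAddChar (-k) =
      ((2 * Real.cos (2 * Real.pi * k.val / m) : ℝ) : ℂ) := by
  rw [AddChar.map_neg_eq_conj, Complex.add_conj, ZMod.stdAddChar_apply, ZMod.toCircle_apply]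
  have : 2 * (Real.pi : ℂ) * Complex.I * k.val / m =
      ((2 * Real.pi * k.val / m : ℝ) : ℂ) * Complex.I := by
    push_cast
    ring
  rw [this, Complex.exp_ofReal_mul_I_re]

theorem prod_zmod_val_eq_prod_Icc {M : Type*} [CommMonoid M] {m : ℕ} [NeZero m] (f : ℕ → M)
    (hf : f 0 = f m) : ∏ k : ZMod m, f k.val = ∏ k ∈ Finset.Icc 1 m, f k := by
  obtain ⟨n, rfl⟩ := Nat.exists_eq_succ_of_ne_zero (NeZero.ne m)
  have h : ∏ k : ZMod (n + 1), f k.val = ∏ k ∈ Finset.range (n + 1), f k :=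
    Fin.prod_univ_eq_prod_range f (n + 1)
  rw [h, Finset.prod_range_succ', hf, ← Finset.prod_range_succ (fun k => f (k + 1)),
    Finset.range_eq_Ico, Finset.prod_Ico_add' f 0 (n + 1) 1]
  rfl

theorem cos_sub_cos_two_pi_div_neg {m k : ℕ} (hk : 2 ≤ k) (hkm : k + 2 ≤ m) :
    2 * Real.cos (2 * Real.pi * k / m) - 2 * Real.cos (2 * Real.pi / m) < 0 := by
  have hm : (0 : ℝ) < m := by exact_mod_cast (by omega : 0 < m)
  have hk' : (2 : ℝ) ≤ k := by exact_mod_cast hk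
  have hkm' : (k : ℝ) + 2 ≤ m := by exact_mod_cast hkm
  have hpi := Real.pi_pos
  have sin_pos : ∀ x : ℝ, 0 < x → x < m → 0 < Real.sin (Real.pi * x / m) := fun x h0 h1 =>
    Real.sin_pos_of_pos_of_lt_pi (by positivity) (by rw [div_lt_iff₀ hm]; gcongr)
  have h1 := sin_pos (k + 1) (by linarith) (by linarith)
  have h2 := sin_pos (k - 1) (by linarith) (by linarith)
  have h3 := Real.cos_sub_cos (2 * Real.pi * k / m) (2 * Real.pi / m)
  rw [show (2 * Real.pi * k / m + 2 * Real.pi / m) / 2 = Real.pi * (k + 1) / m by ring,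
    show (2 * Real.pi * k / m - 2 * Real.pi / m) / 2 = Real.pi * (k - 1) / m by ring] at h3
  nlinarith [mul_pos h1 h2]

theorem cos_two_pi_mul_pred_div {m : ℕ} (hm : 1 ≤ m) :
    Real.cos (2 * Real.pi * (m - 1 : ℕ) / m) = Real.cos (2 * Real.pi / m) := by
  have hm' : (m : ℝ) ≠ 0 := by exact_mod_cast (by omega : m ≠ 0)
  rw [← Real.cos_two_pi_sub (2 * Real.pi / m), Nat.cast_sub hm]
  congr 1
  field_simp
  push_cast
  ring

theorem cos_two_pi_div_lt_one {m : ℕ} (hm : 2 ≤ m) : Real.cos (2 * Real.pi / m) < 1 := by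
  have hm' : (2 : ℝ) ≤ m := by exact_mod_cast hm
  have hpi := Real.pi_pos
  rw [← Real.cos_zero]
  refine Real.cos_lt_cos_of_nonneg_of_le_pi le_rfl ?_ (by positivity)
  rw [div_le_iff₀ (by linarith)]
  nlinarith

theorem charpoly_eq_prod_of_circulant {m : ℕ} [NeZero m] (hm : 3 ≤ m)
    (N : Matrix (ZMod m) (ZMod m) ℝ) (a : ℝ)
    (hN : ∀ j k : ZMod m, N j k =
      if k = j then a else if k = j + 1 ∨ k = j - 1 then 1 else 0) :
    N.charpoly = ∏ k ∈ Finset.Icc 1 m, (X - C (2 * Real.cos (2 * Real.pi * k / m) + a)) := by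
  have h_one : (1 : ZMod m) ≠ 0 := by
    have : Fact (1 < m) := ⟨by omega⟩
    exact one_ne_zero
  have h_two : (1 : ZMod m) + 1 ≠ 0 := by
    intro h
    have h' : ((2 : ℕ) : ZMod m) = 0 := by rw [← h]; norm_num
    have := Nat.le_of_dvd (by norm_num) ((ZMod.natCast_eq_zero_iff 2 m).mp h')
    omega
  have entry : ∀ j l : ZMod m, (N j l : ℂ) =
      (if l = j then (a : ℂ) else 0) + (if l = j + 1 then 1 else 0) +
        (if l = j - 1 then 1 else 0) := by
    intro j l
    have h1 : j ≠ j + 1 := fun h => h_one (by linear_combination -h)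
    have h2 : j ≠ j - 1 := fun h => h_one (by linear_combination h)
    have h3 : j + 1 ≠ j - 1 := fun h => h_two (by linear_combination h)
    rw [hN]
    by_cases hl : l = j
    · subst hl
      simp [h1, h2]
    by_cases hl1 : l = j + 1
    · subst hl1
      simp [h3, h1.symm]
    · by_cases hl2 : l = j - 1 <;> simp [hl, hl1, hl2, h2.symm, h3.symm]
  have diag : N.map Complex.ofRealHom *
      (Matrix.of fun j k : ZMod m => ZMod.stdAddChar (j * k)) =
      (Matrix.of fun j k : ZMod m => ZMod.stdAddChar (j * k)) *
        Matrix.diagonal fun k : ZMod m =>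
          ((2 * Real.cos (2 * Real.pi * k.val / m) + a : ℝ) : ℂ) := by
    ext j k
    rw [Matrix.mul_diagonal, Matrix.mul_apply, Complex.ofReal_add,
      ← stdAddChar_add_stdAddChar_neg]
    simp only [Matrix.map_apply, Matrix.of_apply, Complex.ofRealHom_eq_coe, entry, add_mul,
      ite_mul, zero_mul, one_mul, Finset.sum_add_distrib, Finset.sum_ite_eq',
      Finset.mem_univ, if_true]
    rw [sub_mul, one_mul, sub_eq_add_neg, AddChar.map_add_eq_mul, AddChar.map_add_eq_mul]
    ring
  apply Polynomial.map_injective Complex.ofRealHom Complex.ofReal_injective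
  rw [← Matrix.charpoly_map, charpoly_eq_prod_of_mul_eq_mul_diagonal (isUnit_of_stdAddChar m) diag,
    Polynomial.map_prod]
  simp only [Polynomial.map_sub, map_X, map_C, Complex.ofRealHom_eq_coe]
  refine prod_zmod_val_eq_prod_Icc
    (fun k : ℕ => X - C ((2 * Real.cos (2 * Real.pi * k / m) + a : ℝ) : ℂ)) ?_
  have hm' : (m : ℝ) ≠ 0 := Nat.cast_ne_zero.mpr (NeZero.ne m)
  simp [hm']

/-- The characteristic polynomial and eigenvalue signs of the circulant matrix with
diagonal `-2cos(2π/m)` and `1` on the two off-diagonals (mod `m`). -/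
theorem circulant_charpoly_eigenvalues (m : ℕ) [NeZero m] (hm : 3 ≤ m)
    (N : Matrix (ZMod m) (ZMod m) ℝ)
    (hN : ∀ j k : ZMod m, N j k =
      if k = j then -2 * Real.cos (2 * Real.pi / m)
      else if k = j + 1 ∨ k = j - 1 then 1
      else 0) :
    N.charpoly = ∏ k ∈ Finset.Icc 1 m,
        (X - Polynomial.C (2 * Real.cos (2 * Real.pi * k / m) - 2 * Real.cos (2 * Real.pi / m))) ∧
    ((Finset.Icc 1 m).filter fun k : ℕ =>
      0 < 2 * Real.cos (2 * Real.pi * k / m) - 2 * Real.cos (2 * Real.pi / m)).card = 1 ∧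
    ((Finset.Icc 1 m).filter fun k : ℕ =>
      2 * Real.cos (2 * Real.pi * k / m) - 2 * Real.cos (2 * Real.pi / m) = 0).card = 2 ∧
    ((Finset.Icc 1 m).filter fun k : ℕ =>
      2 * Real.cos (2 * Real.pi * k / m) - 2 * Real.cos (2 * Real.pi / m) < 0).card = m - 3 := by
  have h_last : 0 < 2 * Real.cos (2 * Real.pi * m / m) - 2 * Real.cos (2 * Real.pi / m) := by
    have hm' : (m : ℝ) ≠ 0 := Nat.cast_ne_zero.mpr (NeZero.ne m)
    rw [mul_div_cancel_right₀ _ hm', Real.cos_two_pi]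
    linarith [cos_two_pi_div_lt_one (m := m) (by omega)]
  have h_first :
      2 * Real.cos (2 * Real.pi * (1 : ℕ) / m) - 2 * Real.cos (2 * Real.pi / m) = 0 := by
    simp
  have h_pred :
      2 * Real.cos (2 * Real.pi * (m - 1 : ℕ) / m) - 2 * Real.cos (2 * Real.pi / m) = 0 := by
    rw [cos_two_pi_mul_pred_div (by omega), sub_self]
  have cases_k : ∀ k : ℕ, 1 ≤ k ∧ k ≤ m → k = m ∨ k = 1 ∨ k = m - 1 ∨ 2 ≤ k ∧ k + 2 ≤ m := by
    omega
  refine ⟨?_, ?_, ?_, ?_⟩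
  · rw [charpoly_eq_prod_of_circulant hm N _ hN]
    simp only [neg_mul, sub_eq_add_neg]
  · rw [Finset.card_eq_one]
    refine ⟨m, Finset.ext fun k => ?_⟩
    rw [Finset.mem_filter, Finset.mem_Icc, Finset.mem_singleton]
    constructor
    · rintro ⟨hk, h⟩
      rcases cases_k k hk with rfl | rfl | rfl | ⟨h1, h2⟩
      · rfl
      · exact absurd h_first h.ne'
      · exact absurd h_pred h.ne'
      · exact absurd h (cos_sub_cos_two_pi_div_neg h1 h2).not_gt
    · rintro rfl
      exact ⟨by omega, h_last⟩
  · rw [Finset.card_eq_two]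
    refine ⟨1, m - 1, by omega, Finset.ext fun k => ?_⟩
    rw [Finset.mem_filter, Finset.mem_Icc, Finset.mem_insert, Finset.mem_singleton]
    constructor
    · rintro ⟨hk, h⟩
      rcases cases_k k hk with rfl | rfl | rfl | ⟨h1, h2⟩
      · exact absurd h h_last.ne'
      · exact Or.inl rfl
      · exact Or.inr rfl
      · exact absurd h (cos_sub_cos_two_pi_div_neg h1 h2).ne
    · rintro (rfl | rfl)
      · exact ⟨by omega, h_first⟩
      · exact ⟨by omega, h_pred⟩
  · trans (Finset.Icc 2 (m - 2)).card
    · congr 1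
      ext k
      rw [Finset.mem_filter, Finset.mem_Icc, Finset.mem_Icc]
      constructor
      · rintro ⟨hk, h⟩
        rcases cases_k k hk with rfl | rfl | rfl | h12
        · exact absurd h h_last.not_gt
        · exact absurd h_first h.ne
        · exact absurd h_pred h.ne
        · omega
      · intro hk
        exact ⟨by omega, cos_sub_cos_two_pi_div_neg (by omega) (by omega)⟩
    · rw [Nat.card_Icc]
      omega
end

section
/- The matrix M(α) has exactly one positive eigenvalue, the eigenvalue 0 with multiplicity exactly 2 (its kernel is 2-dimensional), and exactly m−3 negative eigenvalues, all counted with multiplicity. That is, the second differential of the area of a convex m-gon with fixed edge directions has signature (+₁, 0₂, −_{m−3}). -/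
/-- The Hessian of the area of a convex `m`-gon with fixed edge normal directions,
as a function of the support numbers: `M_{jj} = −(cot α_{j−1} + cot αⱼ)`,
`M_{j,j+1} = M_{j+1,j} = 1/sin αⱼ`, and `0` elsewhere. -/
noncomputable def polygonHessian (m : ℕ) [NeZero m] (α : ZMod m → ℝ) :
    Matrix (ZMod m) (ZMod m) ℝ :=
  Matrix.of fun j k =>
    if k = j then -(Real.cot (α (j - 1)) + Real.cot (α j))
    else if k = j + 1 then 1 / Real.sin (α j)
    else if j = k + 1 then 1 / Real.sin (α k)
    else 0

/-- The matrix `polygonHessian m α` acts on vectors as a second order difference operator. -/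
theorem polygonHessian_mulVec (m : ℕ) [NeZero m] (hm : 3 ≤ m) (α g : ZMod m → ℝ) (j : ZMod m) :
    (polygonHessian m α).mulVec g j =
      -(Real.cot (α (j - 1)) + Real.cot (α j)) * g j + g (j + 1) / Real.sin (α j)
        + g (j - 1) / Real.sin (α (j - 1)) := by
  have : Fact (1 < m) := ⟨by omega⟩
  have h1 : (1 : ZMod m) ≠ 0 := one_ne_zero
  have h2 : (1 : ZMod m) + 1 ≠ 0 := by
    intro h
    have h' : ((2 : ℕ) : ZMod m) = 0 := by push_cast; rw [← h]; norm_num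
    rw [ZMod.natCast_eq_zero_iff] at h'
    have := Nat.le_of_dvd (by norm_num) h'
    omega
  have e1 : j + 1 ≠ j := by simp [h1]
  have e2 : j - 1 ≠ j := by simp [h1]
  have e3 : j - 1 ≠ j + 1 := by
    intro h
    apply h2
    have : j + 1 - (j - 1) = 0 := by rw [h]; ring
    linear_combination this
  have key : ∀ k, polygonHessian m α j k * g k =
      (if k = j then -(Real.cot (α (j - 1)) + Real.cot (α j)) * g j else 0)
      + (if k = j + 1 then g (j + 1) / Real.sin (α j) else 0)
      + (if k = j - 1 then g (j - 1) / Real.sin (α (j - 1)) else 0) := by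
    intro k
    have e4 : j = k + 1 ↔ k = j - 1 := by
      rw [eq_sub_iff_add_eq, eq_comm]
    simp only [polygonHessian, Matrix.of_apply, e4]
    by_cases hk : k = j
    · subst hk
      simp [e1.symm, e2.symm]
    by_cases hk1 : k = j + 1
    · subst hk1
      simp [e1, e3.symm]
      ring
    by_cases hk2 : k = j - 1
    · subst hk2
      simp [e2, e3]
      ring
    simp [hk, hk1, hk2]
  simp only [Matrix.mulVec, dotProduct, key, Finset.sum_add_distrib, Finset.sum_ite_eq',
    Finset.mem_univ, if_true]

/-- Twice the area of a polygon as a sum over its vertices. -/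
theorem polygonHessian_quadraticForm (m : ℕ) [NeZero m] (hm : 3 ≤ m) (α g : ZMod m → ℝ) :
    g ⬝ᵥ (polygonHessian m α).mulVec g =
      ∑ j, (2 * g j * g (j + 1) / Real.sin (α j)
        - Real.cot (α j) * (g j ^ 2 + g (j + 1) ^ 2)) := by
  have shift (F : ZMod m → ℝ) : ∑ j, F (j + 1) = ∑ j, F j :=
    Equiv.sum_comp (Equiv.addRight (1 : ZMod m)) F
  simp only [dotProduct, polygonHessian_mulVec m hm]
  have e : ∀ j, g j * (-(Real.cot (α (j - 1)) + Real.cot (α j)) * g j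
      + g (j + 1) / Real.sin (α j) + g (j - 1) / Real.sin (α (j - 1)))
      = (g j * g (j + 1) / Real.sin (α j) - Real.cot (α j) * g j ^ 2)
      + (g j * g (j - 1) / Real.sin (α (j - 1)) - Real.cot (α (j - 1)) * g j ^ 2) := by
    intro j; ring
  simp only [e, Finset.sum_add_distrib]
  rw [← shift fun j => g j * g (j - 1) / Real.sin (α (j - 1)) - Real.cot (α (j - 1)) * g j ^ 2,
    ← Finset.sum_add_distrib]
  refine Finset.sum_congr rfl fun j _ => ?_
  rw [add_sub_cancel_right]
  ring

theorem ZMod.sum_univ_eq_sum_range (m : ℕ) [NeZero m] (F : ZMod m → ℝ) :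
    ∑ j, F j = ∑ n ∈ Finset.range m, F (n : ZMod m) := by
  symm
  refine Finset.sum_bij (fun n _ => (n : ZMod m)) (by simp) ?_ ?_ (by simp)
  · intro a ha b hb h
    rw [Finset.mem_range] at ha hb
    rw [← ZMod.val_cast_of_lt ha, ← ZMod.val_cast_of_lt hb, h]
  · intro b _
    exact ⟨b.val, Finset.mem_range.2 (ZMod.val_lt b), ZMod.natCast_zmod_val b⟩

/-- The angle that the `n`-th outer edge normal makes with the `0`-th one. -/
noncomputable def normalAngle (m : ℕ) (α : ZMod m → ℝ) (n : ℕ) : ℝ :=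
  ∑ i ∈ Finset.range n, α (i : ZMod m)

theorem normalAngle_succ (m : ℕ) (α : ZMod m → ℝ) (n : ℕ) :
    normalAngle m α (n + 1) = normalAngle m α n + α (n : ZMod m) :=
  Finset.sum_range_succ _ _

theorem normalAngle_zero (m : ℕ) (α : ZMod m → ℝ) : normalAngle m α 0 = 0 := by
  simp [normalAngle]

theorem normalAngle_strictMono (m : ℕ) (α : ZMod m → ℝ) (hα : ∀ j, 0 < α j) :
    StrictMono (normalAngle m α) :=
  strictMono_nat_of_lt_succ fun n => by rw [normalAngle_succ]; linarith [hα n]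

theorem normalAngle_self (m : ℕ) [NeZero m] (α : ZMod m → ℝ) (hsum : ∑ j, α j = 2 * Real.pi) :
    normalAngle m α m = 2 * Real.pi := by
  rw [← hsum, ZMod.sum_univ_eq_sum_range, normalAngle]

/-- The change of the support numbers under translation of the polygon by `(A, B)`. -/
noncomputable def translationVector (m : ℕ) (α : ZMod m → ℝ) (A B : ℝ) (j : ZMod m) : ℝ :=
  A * Real.cos (normalAngle m α j.val) + B * Real.sin (normalAngle m α j.val)

theorem translationVector_natCast (m : ℕ) [NeZero m] (α : ZMod m → ℝ)
    (hsum : ∑ j, α j = 2 * Real.pi) (A B : ℝ) (n : ℕ) (hn : n ≤ m) :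
    translationVector m α A B (n : ZMod m) =
      A * Real.cos (normalAngle m α n) + B * Real.sin (normalAngle m α n) := by
  rcases hn.lt_or_eq with h | rfl
  · rw [translationVector, ZMod.val_cast_of_lt h]
  · simp [translationVector, normalAngle_self n α hsum, normalAngle_zero]

theorem translationVector_add_one (m : ℕ) [NeZero m] (α : ZMod m → ℝ)
    (hsum : ∑ j, α j = 2 * Real.pi) (A B : ℝ) (j : ZMod m) :
    translationVector m α A B (j + 1) =
      A * Real.cos (normalAngle m α j.val + α j) + B * Real.sin (normalAngle m α j.val + α j) := by
  have h := translationVector_natCast m α hsum A B (j.val + 1) (ZMod.val_lt j)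
  rw [normalAngle_succ] at h
  simpa using h

theorem polygonHessian_mulVec_translationVector (m : ℕ) [NeZero m] (hm : 3 ≤ m) (α : ZMod m → ℝ)
    (hα : ∀ j, 0 < α j ∧ α j < Real.pi) (hsum : ∑ j, α j = 2 * Real.pi) (A B : ℝ) :
    (polygonHessian m α).mulVec (translationVector m α A B) = 0 := by
  have sin_ne (j) : Real.sin (α j) ≠ 0 := (Real.sin_pos_of_pos_of_lt_pi (hα j).1 (hα j).2).ne'
  have forward (j : ZMod m) : translationVector m α A B (j + 1) / Real.sin (α j)
      - Real.cot (α j) * translationVector m α A B j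
      = translationVector m α B (-A) j := by
    rw [translationVector_add_one m α hsum, Real.cot_eq_cos_div_sin, Real.cos_add, Real.sin_add]
    have := sin_ne j
    simp only [translationVector]
    field_simp
    ring
  have backward (j : ZMod m) : translationVector m α A B j / Real.sin (α j)
      - Real.cot (α j) * translationVector m α A B (j + 1)
      = -translationVector m α B (-A) (j + 1) := by
    rw [translationVector_add_one m α hsum, translationVector_add_one m α hsum,
      Real.cot_eq_cos_div_sin, Real.cos_add, Real.sin_add]
    have := sin_ne j
    simp only [translationVector]
    field_simp
    linear_combination (-(A * Real.cos (normalAngle m α j.val)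
      + B * Real.sin (normalAngle m α j.val))) * Real.sin_sq_add_cos_sq (α j)
  funext j
  have h1 := forward j
  have h2 := backward (j - 1)
  rw [sub_add_cancel] at h2
  rw [polygonHessian_mulVec m hm, Pi.zero_apply]
  linear_combination h1 + h2

/-- The discrete Picone inequality comparing a solution of `f'' + f = 0` on `[t, t + a]` with the
sine function. -/
theorem vertexForm_le (a t x y : ℝ) (ha : 0 < Real.sin a) (hx : Real.sin t = 0 → x = 0)
    (hy : Real.sin (t + a) = 0 → y = 0)
    (h : 0 ≤ Real.sin t * Real.sin (t + a) ∨ x * Real.sin (t + a) = y * Real.sin t) :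
    2 * x * y / Real.sin a - Real.cot a * (x ^ 2 + y ^ 2) ≤
      Real.cot t * x ^ 2 - Real.cot (t + a) * y ^ 2 := by
  obtain ⟨u, rfl⟩ : ∃ u, x = u * Real.sin t := by
    by_cases hs : Real.sin t = 0
    · exact ⟨0, by simp [hx hs]⟩
    · exact ⟨x / Real.sin t, by field_simp⟩
  obtain ⟨v, rfl⟩ : ∃ v, y = v * Real.sin (t + a) := by
    by_cases hs : Real.sin (t + a) = 0
    · exact ⟨0, by simp [hy hs]⟩
    · exact ⟨y / Real.sin (t + a), by field_simp⟩
  have cot_mul (s w : ℝ) : Real.cot s * (w * Real.sin s) ^ 2 =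
      w ^ 2 * Real.sin s * Real.cos s := by
    rw [Real.cot_eq_cos_div_sin]
    by_cases hs : Real.sin s = 0
    · simp [hs]
    · field_simp
  have hnn : 0 ≤ Real.sin t * Real.sin (t + a) * (u - v) ^ 2 := by
    rcases h with h | h
    · positivity
    · apply le_of_eq
      linear_combination (-(u - v)) * h
  have hid : 2 * (u * Real.sin t) * (v * Real.sin (t + a)) / Real.sin a
      - Real.cot a * ((u * Real.sin t) ^ 2 + (v * Real.sin (t + a)) ^ 2)
      = u ^ 2 * Real.sin t * Real.cos t - v ^ 2 * Real.sin (t + a) * Real.cos (t + a)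
        - Real.sin t * Real.sin (t + a) * (u - v) ^ 2 / Real.sin a := by
    rw [Real.cot_eq_cos_div_sin, Real.sin_add, Real.cos_add]
    field_simp
    linear_combination (-(v ^ 2) * (Real.sin t * Real.cos a + Real.cos t * Real.sin a) * Real.sin t)
      * Real.sin_sq_add_cos_sq a
  rw [cot_mul, cot_mul, hid]
  have := div_nonneg hnn ha.le
  linarith

/-- A support vector whose interpolation by solutions of `f'' + f = 0` vanishes at `0` and `π` has
nonpositive area. -/
theorem polygonHessian_quadraticForm_nonpos (m : ℕ) [NeZero m] (hm : 3 ≤ m) (α : ZMod m → ℝ)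
    (hα : ∀ j, 0 < α j ∧ α j < Real.pi) (hsum : ∑ j, α j = 2 * Real.pi) (k : ℕ)
    (hk : normalAngle m α k < Real.pi) (hk' : Real.pi ≤ normalAngle m α (k + 1))
    (g : ZMod m → ℝ) (h0 : g 0 = 0)
    (hπ : g (k : ZMod m) * Real.sin (normalAngle m α (k + 1)) =
      g ((k + 1 : ℕ) : ZMod m) * Real.sin (normalAngle m α k)) :
    g ⬝ᵥ (polygonHessian m α).mulVec g ≤ 0 := by
  have mono := normalAngle_strictMono m α fun j => (hα j).1
  have t0 := normalAngle_zero m α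
  have tm := normalAngle_self m α hsum
  have hpi := Real.pi_pos
  have nonneg (n) : 0 ≤ normalAngle m α n := t0 ▸ mono.monotone (Nat.zero_le n)
  have hvanish (n : ℕ) (hn : n ≤ m) (hs : Real.sin (normalAngle m α n) = 0) :
      g (n : ZMod m) = 0 := by
    rcases Nat.eq_zero_or_pos n with rfl | hpos
    · simpa using h0
    rcases hn.lt_or_eq with hlt | rfl
    · have l1 : 0 < normalAngle m α n := t0 ▸ mono hpos
      have l2 : normalAngle m α n < 2 * Real.pi := tm ▸ mono hlt
      have hnπ : normalAngle m α n = Real.pi := by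
        rcases lt_trichotomy (normalAngle m α n) Real.pi with h | h | h
        · exact absurd hs (Real.sin_pos_of_pos_of_lt_pi l1 h).ne'
        · exact h
        · have : 0 < Real.sin (normalAngle m α n - Real.pi) :=
            Real.sin_pos_of_pos_of_lt_pi (by linarith) (by linarith)
          rw [Real.sin_sub_pi, hs] at this
          simp at this
      have hkn : k < n := mono.lt_iff_lt.1 (hnπ ▸ hk)
      have hnk : n ≤ k + 1 := mono.le_iff_le.1 (hnπ ▸ hk')
      obtain rfl : n = k + 1 := by omega
      rw [hs, mul_zero, eq_comm, mul_eq_zero] at hπ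
      refine hπ.resolve_right (Real.sin_pos_of_pos_of_lt_pi ?_ hk).ne'
      have := normalAngle_succ m α k
      linarith [(hα k).2]
    · simpa using h0
  have hle : ∀ n ∈ Finset.range m,
      2 * g (n : ZMod m) * g ((n : ZMod m) + 1) / Real.sin (α n)
        - Real.cot (α n) * (g (n : ZMod m) ^ 2 + g ((n : ZMod m) + 1) ^ 2) ≤
      Real.cot (normalAngle m α n) * g (n : ZMod m) ^ 2
        - Real.cot (normalAngle m α (n + 1)) * g ((n + 1 : ℕ) : ZMod m) ^ 2 := by
    intro n hn
    rw [Finset.mem_range] at hn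
    have hy := hvanish (n + 1) hn
    rw [normalAngle_succ] at hy
    rw [normalAngle_succ]
    push_cast at hy ⊢
    refine vertexForm_le _ _ _ _ (Real.sin_pos_of_pos_of_lt_pi (hα _).1 (hα _).2)
      (hvanish n hn.le) hy ?_
    rw [← normalAngle_succ]
    have hlast : normalAngle m α (n + 1) ≤ 2 * Real.pi := tm ▸ mono.monotone hn
    have hstep : normalAngle m α n < normalAngle m α (n + 1) := mono n.lt_succ_self
    rcases lt_trichotomy n k with h | rfl | h
    · left
      have : normalAngle m α (n + 1) ≤ normalAngle m α k := mono.monotone h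
      exact mul_nonneg (Real.sin_nonneg_of_nonneg_of_le_pi (nonneg _) (by linarith))
        (Real.sin_nonneg_of_nonneg_of_le_pi (nonneg _) (by linarith))
    · right
      simpa using hπ
    · left
      have : normalAngle m α (k + 1) ≤ normalAngle m α n := mono.monotone h
      have p1 := Real.sin_nonneg_of_nonneg_of_le_pi (x := normalAngle m α n - Real.pi)
        (by linarith) (by linarith)
      have p2 := Real.sin_nonneg_of_nonneg_of_le_pi (x := normalAngle m α (n + 1) - Real.pi)
        (by linarith) (by linarith)
      rw [Real.sin_sub_pi] at p1 p2
      exact mul_nonneg_of_nonpos_of_nonpos (by linarith) (by linarith)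
  rw [polygonHessian_quadraticForm m hm, ZMod.sum_univ_eq_sum_range]
  refine (Finset.sum_le_sum hle).trans ?_
  rw [Finset.sum_range_sub' fun n : ℕ => Real.cot (normalAngle m α n) * g (n : ZMod m) ^ 2]
  simp [h0]

/-- The area form is negative semidefinite on a hyperplane. -/
theorem exists_hyperplane_polygonHessian_nonpos (m : ℕ) [NeZero m] (hm : 3 ≤ m) (α : ZMod m → ℝ)
    (hα : ∀ j, 0 < α j ∧ α j < Real.pi) (hsum : ∑ j, α j = 2 * Real.pi)
    (hHerm : (polygonHessian m α).IsHermitian) :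
    ∃ ψ : (ZMod m → ℝ) →ₗ[ℝ] ℝ, ∀ g, ψ g = 0 → g ⬝ᵥ (polygonHessian m α).mulVec g ≤ 0 := by
  have tm := normalAngle_self m α hsum
  have hpi := Real.pi_pos
  have hex : ∃ n, Real.pi ≤ normalAngle m α n := ⟨m, by linarith⟩
  obtain ⟨k, hk, hk', hkm⟩ : ∃ k, normalAngle m α k < Real.pi ∧
      Real.pi ≤ normalAngle m α (k + 1) ∧ k + 1 ≤ m := by
    classical
    have hpos : Nat.find hex ≠ 0 := by
      intro h
      have := Nat.find_spec hex
      rw [h, normalAngle_zero] at this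
      linarith
    obtain ⟨k, hk⟩ := Nat.exists_eq_succ_of_ne_zero hpos
    refine ⟨k, ?_, ?_, ?_⟩
    · exact not_le.1 (Nat.find_min hex (by omega))
    · rw [← Nat.succ_eq_add_one, ← hk]
      exact Nat.find_spec hex
    · rw [← Nat.succ_eq_add_one, ← hk]
      exact Nat.find_min' hex (by linarith)
  let ψ : (ZMod m → ℝ) →ₗ[ℝ] ℝ :=
    Real.sin (α k) • LinearMap.proj (0 : ZMod m)
      + Real.sin (normalAngle m α k) • LinearMap.proj ((k + 1 : ℕ) : ZMod m)
      - Real.sin (normalAngle m α (k + 1)) • LinearMap.proj (k : ZMod m)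
  refine ⟨ψ, fun g hg => ?_⟩
  have hg' : Real.sin (α k) * g 0
      + Real.sin (normalAngle m α k) * g ((k + 1 : ℕ) : ZMod m)
      - Real.sin (normalAngle m α (k + 1)) * g (k : ZMod m) = 0 := hg
  set w := translationVector m α (g 0) 0 with hw
  have hker : (polygonHessian m α).mulVec w = 0 :=
    polygonHessian_mulVec_translationVector m hm α hα hsum _ _
  have hwk (n : ℕ) (hn : n ≤ m) : w (n : ZMod m) = g 0 * Real.cos (normalAngle m α n) := by
    rw [hw, translationVector_natCast m α hsum _ _ n hn]; ring
  have hmain := polygonHessian_quadraticForm_nonpos m hm α hα hsum k hk hk' (g - w)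
    (by
      have := hwk 0 (Nat.zero_le _)
      rw [normalAngle_zero] at this
      simp at this
      simp [this])
    (by
      rw [Pi.sub_apply, Pi.sub_apply, hwk k (by omega), hwk (k + 1) hkm]
      rw [normalAngle_succ] at hg' ⊢
      rw [Real.cos_add]
      rw [Real.sin_add] at hg' ⊢
      linear_combination (-1) * hg' - g 0 * Real.sin (α k)
        * Real.sin_sq_add_cos_sq (normalAngle m α k))
  have hT : (polygonHessian m α).transpose = polygonHessian m α := by
    rw [← Matrix.conjTranspose_eq_transpose_of_trivial, hHerm.eq]
  have hw0 : w ⬝ᵥ (polygonHessian m α).mulVec g = 0 := by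
    rw [Matrix.dotProduct_mulVec, ← Matrix.mulVec_transpose, hT, hker, zero_dotProduct]
  rwa [Matrix.mulVec_sub, hker, sub_zero, sub_dotProduct, hw0, sub_zero] at hmain

theorem polygonHessian_ones_pos (m : ℕ) [NeZero m] (hm : 3 ≤ m) (α : ZMod m → ℝ)
    (hα : ∀ j, 0 < α j ∧ α j < Real.pi) :
    0 < (1 : ZMod m → ℝ) ⬝ᵥ (polygonHessian m α).mulVec 1 := by
  rw [polygonHessian_quadraticForm m hm]
  refine Finset.sum_pos (fun j _ => ?_) Finset.univ_nonempty
  have hs := Real.sin_pos_of_pos_of_lt_pi (hα j).1 (hα j).2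
  have hc : Real.cos (α j) < 1 := by
    nlinarith [Real.sin_sq_add_cos_sq (α j), Real.cos_le_one (α j)]
  rw [Real.cot_eq_cos_div_sin]
  have : (2 * (1 : ZMod m → ℝ) j * (1 : ZMod m → ℝ) (j + 1) / Real.sin (α j)
      - Real.cos (α j) / Real.sin (α j) * ((1 : ZMod m → ℝ) j ^ 2 + (1 : ZMod m → ℝ) (j + 1) ^ 2))
      = 2 * (1 - Real.cos (α j)) / Real.sin (α j) := by
    simp only [Pi.one_apply]; ring
  rw [this]
  have : 0 < 1 - Real.cos (α j) := by linarith
  positivity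

/-- The kernel consists of the infinitesimal translations. -/
theorem finrank_ker_polygonHessian (m : ℕ) [NeZero m] (hm : 3 ≤ m) (α : ZMod m → ℝ)
    (hα : ∀ j, 0 < α j ∧ α j < Real.pi) (hsum : ∑ j, α j = 2 * Real.pi) :
    Module.finrank ℝ (LinearMap.ker (polygonHessian m α).mulVecLin) = 2 := by
  have sin_ne (j) : Real.sin (α j) ≠ 0 := (Real.sin_pos_of_pos_of_lt_pi (hα j).1 (hα j).2).ne'
  let f : LinearMap.ker (polygonHessian m α).mulVecLin →ₗ[ℝ] ℝ × ℝ :=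
    ((LinearMap.proj (0 : ZMod m)).prod (LinearMap.proj (1 : ZMod m))).comp (Submodule.subtype _)
  have hf (x) : f x = (x.1 0, x.1 1) := rfl
  have hinj : Function.Injective f := by
    rw [← LinearMap.ker_eq_bot, LinearMap.ker_eq_bot']
    rintro ⟨g, hg⟩ h
    rw [hf, Prod.mk_eq_zero] at h
    rw [LinearMap.mem_ker, Matrix.mulVecLin_apply] at hg
    have hrec (n : ℕ) : g (n : ZMod m) = 0 ∧ g ((n : ZMod m) + 1) = 0 := by
      induction n with
      | zero => simpa using h
      | succ n ih =>
        have hrow := congrFun hg ((n : ZMod m) + 1)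
        rw [polygonHessian_mulVec m hm, add_sub_cancel_right, ih.1, ih.2] at hrow
        push_cast
        exact ⟨ih.2, by simpa [sin_ne] using hrow⟩
    ext j
    simpa using (hrec j.val).1
  have hsurj : Function.Surjective f := by
    rintro ⟨u, v⟩
    refine ⟨⟨translationVector m α u ((v - u * Real.cos (α 0)) / Real.sin (α 0)),
      polygonHessian_mulVec_translationVector m hm α hα hsum _ _⟩, ?_⟩
    have h0 := translationVector_natCast m α hsum u
      ((v - u * Real.cos (α 0)) / Real.sin (α 0)) 0 (by omega)
    have h1 := translationVector_natCast m α hsum u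
      ((v - u * Real.cos (α 0)) / Real.sin (α 0)) 1 (by omega)
    have := sin_ne 0
    rw [normalAngle_succ] at h1
    simp only [normalAngle_zero, Nat.cast_zero, Nat.cast_one, Real.cos_zero, Real.sin_zero,
      zero_add] at h0 h1
    rw [hf]
    ext
    · simp [h0]
    · simp only [h1]
      field_simp
      ring
  rw [(LinearEquiv.ofBijective f ⟨hinj, hsurj⟩).finrank_eq]
  simp

namespace Matrix.IsHermitian

variable {n : Type*} [Fintype n] [DecidableEq n] {A : Matrix n n ℝ}

theorem card_eigenvalues_eq_zero (hA : A.IsHermitian) :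
    (Finset.univ.filter fun i => hA.eigenvalues i = 0).card =
      Module.finrank ℝ (LinearMap.ker A.mulVecLin) := by
  have h1 := hA.rank_eq_card_non_zero_eigs
  rw [Fintype.card_subtype] at h1
  have h2 := LinearMap.finrank_range_add_finrank_ker A.mulVecLin
  rw [Module.finrank_fintype_fun_eq_card, ← Matrix.rank] at h2
  have h3 := Finset.card_filter_add_card_filter_not (s := Finset.univ)
    (fun i => hA.eigenvalues i = 0)
  rw [Finset.card_univ] at h3
  simp only [ne_eq] at h1
  omega

theorem dotProduct_eigenvectorBasis (hA : A.IsHermitian) (i j : n) :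
    (hA.eigenvectorBasis i).ofLp ⬝ᵥ (hA.eigenvectorBasis j).ofLp = if i = j then 1 else 0 := by
  have := orthonormal_iff_ite.1 hA.eigenvectorBasis.orthonormal j i
  simpa [EuclideanSpace.inner_eq_star_dotProduct, eq_comm] using this

theorem quadraticForm_sum_eigenvectorBasis (hA : A.IsHermitian) (c : n → ℝ) :
    (∑ i, c i • (hA.eigenvectorBasis i).ofLp) ⬝ᵥ
      A.mulVec (∑ i, c i • (hA.eigenvectorBasis i).ofLp) = ∑ i, hA.eigenvalues i * c i ^ 2 := by
  simp only [mulVec_sum, mulVec_smul, hA.mulVec_eigenvectorBasis, sum_dotProduct, dotProduct_sum,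
    smul_dotProduct, dotProduct_smul, dotProduct_eigenvectorBasis, smul_eq_mul, mul_ite, mul_one,
    mul_zero, Finset.sum_ite_eq', Finset.mem_univ, if_true]
  exact Finset.sum_congr rfl fun i _ => by ring

theorem exists_eigenvalue_pos (hA : A.IsHermitian) (x : n → ℝ) (hx : 0 < x ⬝ᵥ A.mulVec x) :
    ∃ i, 0 < hA.eigenvalues i := by
  by_contra! h
  have hrepr := congrArg WithLp.ofLp (hA.eigenvectorBasis.sum_repr (WithLp.toLp 2 x))
  simp only [WithLp.ofLp_sum, WithLp.ofLp_smul] at hrepr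
  rw [← hrepr, quadraticForm_sum_eigenvectorBasis] at hx
  exact hx.not_ge (Finset.sum_nonpos fun i _ =>
    mul_nonpos_of_nonpos_of_nonneg (h i) (sq_nonneg _))

theorem card_eigenvalues_pos_le_one (hA : A.IsHermitian) (ψ : (n → ℝ) →ₗ[ℝ] ℝ)
    (hψ : ∀ x, ψ x = 0 → x ⬝ᵥ A.mulVec x ≤ 0) :
    (Finset.univ.filter fun i => 0 < hA.eigenvalues i).card ≤ 1 := by
  rw [Finset.card_le_one]
  simp only [Finset.mem_filter, Finset.mem_univ, true_and]
  intro i hi j hj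
  by_contra hij
  have hQ (a b : ℝ) : (a • (hA.eigenvectorBasis i).ofLp + b • (hA.eigenvectorBasis j).ofLp) ⬝ᵥ
      A.mulVec (a • (hA.eigenvectorBasis i).ofLp + b • (hA.eigenvectorBasis j).ofLp) =
      hA.eigenvalues i * a ^ 2 + hA.eigenvalues j * b ^ 2 := by
    simp [mulVec_add, mulVec_smul, hA.mulVec_eigenvectorBasis, dotProduct_eigenvectorBasis, hij,
      Ne.symm hij]
    ring
  by_cases h0 : ψ (hA.eigenvectorBasis i).ofLp = 0
  · have := hψ ((1 : ℝ) • (hA.eigenvectorBasis i).ofLp + (0 : ℝ) • (hA.eigenvectorBasis j).ofLp)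
      (by simp [h0])
    rw [hQ] at this
    linarith
  · have := hψ (ψ (hA.eigenvectorBasis j).ofLp • (hA.eigenvectorBasis i).ofLp
      + (-ψ (hA.eigenvectorBasis i).ofLp) • (hA.eigenvectorBasis j).ofLp)
      (by simp; ring)
    rw [hQ] at this
    have : 0 < hA.eigenvalues j * (-ψ (hA.eigenvectorBasis i).ofLp) ^ 2 :=
      mul_pos hj (sq_pos_of_ne_zero (neg_ne_zero.2 h0))
    have : 0 ≤ hA.eigenvalues i * ψ (hA.eigenvectorBasis j).ofLp ^ 2 := by positivity
    linarith

end Matrix.IsHermitian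

/-- The second differential of the area of a convex `m`-gon with fixed edge directions
has signature `(+₁, 0₂, −_{m−3})`. -/
theorem polygonHessian_signature (m : ℕ) [NeZero m] (hm : 3 ≤ m)
    (α : ZMod m → ℝ) (hα : ∀ j, 0 < α j ∧ α j < Real.pi)
    (hsum : ∑ j, α j = 2 * Real.pi)
    (hHerm : (polygonHessian m α).IsHermitian) :
    (Finset.univ.filter fun j : ZMod m => 0 < hHerm.eigenvalues j).card = 1 ∧
    (Finset.univ.filter fun j : ZMod m => hHerm.eigenvalues j = 0).card = 2 ∧
    (Finset.univ.filter fun j : ZMod m => hHerm.eigenvalues j < 0).card = m - 3 := by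
  obtain ⟨ψ, hψ⟩ := exists_hyperplane_polygonHessian_nonpos m hm α hα hsum hHerm
  have hle := hHerm.card_eigenvalues_pos_le_one ψ hψ
  obtain ⟨i, hi⟩ := hHerm.exists_eigenvalue_pos 1 (polygonHessian_ones_pos m hm α hα)
  have hge : 0 < (Finset.univ.filter fun j : ZMod m => 0 < hHerm.eigenvalues j).card :=
    Finset.card_pos.2 ⟨i, by simpa using hi⟩
  have hzero := hHerm.card_eigenvalues_eq_zero
  rw [finrank_ker_polygonHessian m hm α hα hsum] at hzero
  have htotal : (Finset.univ.filter fun j : ZMod m => 0 < hHerm.eigenvalues j).card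
      + (Finset.univ.filter fun j : ZMod m => hHerm.eigenvalues j = 0).card
      + (Finset.univ.filter fun j : ZMod m => hHerm.eigenvalues j < 0).card = m := by
    simp only [Finset.card_filter, ← Finset.sum_add_distrib]
    have (j : ZMod m) : ((if 0 < hHerm.eigenvalues j then 1 else 0)
        + (if hHerm.eigenvalues j = 0 then 1 else 0)
        + (if hHerm.eigenvalues j < 0 then 1 else 0) : ℕ) = 1 := by
      rcases lt_trichotomy (hHerm.eigenvalues j) 0 with h | h | h
      · simp [h, h.ne, h.not_gt]
      · simp [h]
      · simp [h, h.ne', h.not_gt]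
    simp [this, ZMod.card]
  omega
end

section
/- Let g ∈ ℝ^m satisfy (M(α)·g)ⱼ ≥ 0 for every j (all edge lengths of the corresponding convex polygon are nonnegative) and ⟨g, M(α)·g⟩ > 0 (the polygon has positive area). Then for every u ∈ ℝ^m with ⟨u, M(α)·g⟩ = 0 (the first variation of the area vanishes) one has ⟨u, M(α)·u⟩ ≤ 0, and equality ⟨u, M(α)·u⟩ = 0 holds if and only if M(α)·u = 0 (all edge lengths are stationary). -/
open Matrix

/-- A symmetric form that is nonpositive on a hyperplane is nonpositive on the orthogonal complement
of any positive vector, and its null vectors there are in the kernel. -/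
theorem Matrix.IsSymm.nonpos_on_orthogonal_of_nonpos_on_ker {n : Type*} [Fintype n]
    {M : Matrix n n ℝ} (hM : M.IsSymm) (l : (n → ℝ) →ₗ[ℝ] ℝ)
    (hl : ∀ w, l w = 0 → w ⬝ᵥ M.mulVec w ≤ 0) {g u : n → ℝ}
    (hg : 0 < g ⬝ᵥ M.mulVec g) (hu : u ⬝ᵥ M.mulVec g = 0) :
    u ⬝ᵥ M.mulVec u ≤ 0 ∧ (u ⬝ᵥ M.mulVec u = 0 ↔ M.mulVec u = 0) := by
  have hsymm : ∀ v w : n → ℝ, v ⬝ᵥ M.mulVec w = w ⬝ᵥ M.mulVec v := fun v w => by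
    rw [dotProduct_comm, ← vecMul_transpose, hM.eq, ← dotProduct_mulVec]
  have hnonpos : ∀ w, w ⬝ᵥ M.mulVec g = 0 → w ⬝ᵥ M.mulVec w ≤ 0 := by
    intro w hw
    have hlg : l g ≠ 0 := fun h => (hl g h).not_gt hg
    have h := hl (l g • w - l w • g) (by simp [mul_comm])
    have hw' : g ⬝ᵥ M.mulVec w = 0 := by rw [hsymm, hw]
    simp only [mulVec_sub, mulVec_smul, sub_dotProduct, dotProduct_sub, smul_dotProduct,
      dotProduct_smul, smul_eq_mul, hw, hw'] at h
    have h1 : 0 < l g ^ 2 := by positivity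
    have h2 : 0 ≤ l w ^ 2 * (g ⬝ᵥ M.mulVec g) := by positivity
    nlinarith
  refine ⟨hnonpos u hu, fun h0 => ?_, fun h => by rw [h, dotProduct_zero]⟩
  set x := M.mulVec u with hx
  set c := (x ⬝ᵥ M.mulVec g) / (g ⬝ᵥ M.mulVec g) with hc
  set v := x - c • g with hv
  have hvg : v ⬝ᵥ M.mulVec g = 0 := by
    rw [hv, sub_dotProduct, smul_dotProduct, smul_eq_mul, hc, div_mul_cancel₀ _ hg.ne', sub_self]
  have hvu : v ⬝ᵥ M.mulVec u = x ⬝ᵥ x := by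
    rw [hv, sub_dotProduct, smul_dotProduct, hsymm g u, hu, smul_zero, sub_zero]
  have hdisc := discrim_le_zero_of_nonpos (K := ℝ) (a := v ⬝ᵥ M.mulVec v)
      (b := 2 * (v ⬝ᵥ M.mulVec u)) (c := 0) fun t => by
    have h := hnonpos (u + t • v) (by
      rw [add_dotProduct, smul_dotProduct, hu, hvg, smul_zero, add_zero])
    simp only [mulVec_add, mulVec_smul, add_dotProduct, dotProduct_add, smul_dotProduct,
      dotProduct_smul, smul_eq_mul] at h
    rw [← hx, h0, hsymm u v] at h
    linarith
  rw [hvu, discrim] at hdisc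
  have hxx : x ⬝ᵥ x = 0 := by nlinarith [sq_nonneg (x ⬝ᵥ x)]
  exact dotProduct_self_eq_zero.1 hxx

theorem ZMod.natCast_ne_zero_of_pos_of_lt {m n : ℕ} (hn : 0 < n) (hnm : n < m) :
    (n : ZMod m) ≠ 0 := by
  rw [Ne, ZMod.natCast_eq_zero_iff]
  exact Nat.not_dvd_of_pos_of_lt hn hnm

theorem polygonHessian_isSymm {m : ℕ} [NeZero m] (hm : 3 ≤ m) (α : ZMod m → ℝ) :
    (polygonHessian m α).IsSymm := by
  have h2 : (2 : ZMod m) ≠ 0 := by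
    exact_mod_cast ZMod.natCast_ne_zero_of_pos_of_lt (n := 2) (by omega) (by omega : 2 < m)
  ext j k
  simp only [polygonHessian, transpose_apply, of_apply]
  by_cases h : k = j
  · subst h; simp
  rw [if_neg h, if_neg (Ne.symm h)]
  by_cases h1 : k = j + 1
  · have : j ≠ k + 1 := fun h' => h2 (by linear_combination -h1 - h')
    simp [h1]
    grind
  · simp [h1]

theorem polygonHessian_mulVec_apply {m : ℕ} [NeZero m] (hm : 3 ≤ m) (α u : ZMod m → ℝ)
    (j : ZMod m) :
    (polygonHessian m α).mulVec u j =
      -(Real.cot (α (j - 1)) + Real.cot (α j)) * u j + 1 / Real.sin (α j) * u (j + 1) +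
        1 / Real.sin (α (j - 1)) * u (j - 1) := by
  have h1 : (1 : ZMod m) ≠ 0 := by
    exact_mod_cast ZMod.natCast_ne_zero_of_pos_of_lt (n := 1) (by omega) (by omega : 1 < m)
  have h2 : (2 : ZMod m) ≠ 0 := by
    exact_mod_cast ZMod.natCast_ne_zero_of_pos_of_lt (n := 2) (by omega) (by omega : 2 < m)
  have hentry : ∀ k, polygonHessian m α j k =
      (if k = j then -(Real.cot (α (j - 1)) + Real.cot (α j)) else 0) +
      (if k = j + 1 then 1 / Real.sin (α j) else 0) +
      (if k = j - 1 then 1 / Real.sin (α (j - 1)) else 0) := by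
    intro k
    simp only [polygonHessian, of_apply]
    by_cases hk : k = j
    · subst hk
      have : k ≠ k - 1 := fun h => h1 (by linear_combination h)
      simp [h1, this]
    by_cases hk1 : k = j + 1
    · subst hk1
      have : j + 1 ≠ j - 1 := fun h => h2 (by linear_combination h)
      simp [h1, this]
    by_cases hk2 : k = j - 1
    · subst hk2
      simp [hk, hk1]
    · have : j ≠ k + 1 := fun h => hk2 (by linear_combination -h)
      simp [hk, hk1, hk2, this]
  simp [mulVec, dotProduct, hentry, add_mul, Finset.sum_add_distrib]

/-- The area form is a sum over the arcs between consecutive edge normals. -/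
theorem polygonHessian_quadratic {m : ℕ} [NeZero m] (hm : 3 ≤ m) (α u : ZMod m → ℝ) :
    u ⬝ᵥ (polygonHessian m α).mulVec u =
      ∑ j, (2 * u j * u (j + 1) - Real.cos (α j) * (u j ^ 2 + u (j + 1) ^ 2)) /
        Real.sin (α j) := by
  have hshift := Equiv.sum_comp (Equiv.addRight (1 : ZMod m)) fun j =>
    (u j * u (j - 1) - Real.cos (α (j - 1)) * u j ^ 2) / Real.sin (α (j - 1))
  simp only [Equiv.coe_addRight, add_sub_cancel_right] at hshift
  have hsplit : ∀ j, (2 * u j * u (j + 1) - Real.cos (α j) * (u j ^ 2 + u (j + 1) ^ 2)) /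
      Real.sin (α j) = (u j * u (j + 1) - Real.cos (α j) * u j ^ 2) / Real.sin (α j) +
        (u (j + 1) * u j - Real.cos (α j) * u (j + 1) ^ 2) / Real.sin (α j) := fun j => by ring
  simp only [hsplit, Finset.sum_add_distrib]
  rw [hshift, ← Finset.sum_add_distrib, dotProduct]
  refine Finset.sum_congr rfl fun j _ => ?_
  rw [polygonHessian_mulVec_apply hm, Real.cot_eq_cos_div_sin, Real.cot_eq_cos_div_sin]
  ring

/-- On one arc, with endpoints `θ` and `φ`, the area form is bounded by a telescoping difference. -/
theorem arc_quadratic_le {θ φ x y : ℝ} (h : 0 < Real.sin (φ - θ))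
    (hx : Real.sin θ = 0 → x = 0) (hy : Real.sin φ = 0 → y = 0)
    (hs : 0 ≤ Real.sin θ * Real.sin φ ∨ Real.sin φ * x = Real.sin θ * y) :
    (2 * x * y - Real.cos (φ - θ) * (x ^ 2 + y ^ 2)) / Real.sin (φ - θ) ≤
      x ^ 2 * Real.cos θ / Real.sin θ - y ^ 2 * Real.cos φ / Real.sin φ := by
  rw [Real.sin_sub] at *
  rw [Real.cos_sub]
  have h1 := Real.sin_sq_add_cos_sq θ
  have h2 := Real.sin_sq_add_cos_sq φ
  generalize Real.sin θ = s at *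
  generalize Real.sin φ = t at *
  generalize Real.cos θ = c at *
  generalize Real.cos φ = d at *
  by_cases hs0 : s = 0
  · subst hs0
    obtain rfl := hx rfl
    have ht0 : t ≠ 0 := by rintro rfl; simp at h
    have hc0 : c ≠ 0 := by rintro rfl; simp at h
    apply le_of_eq
    field_simp
    ring
  by_cases ht0 : t = 0
  · subst ht0
    obtain rfl := hy rfl
    have hd0 : d ≠ 0 := by rintro rfl; simp at h
    apply le_of_eq
    field_simp
    ring
  have key : x ^ 2 * c / s - y ^ 2 * d / t -
      (2 * x * y - (d * c + t * s) * (x ^ 2 + y ^ 2)) / (t * c - d * s) =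
      (t * x - s * y) ^ 2 / (s * t * (t * c - d * s)) := by
    obtain ⟨D, hD⟩ : ∃ D, D = t * c - d * s := ⟨_, rfl⟩
    rw [← hD] at h ⊢
    have := h.ne'
    field_simp
    linear_combination (t ^ 2 * x ^ 2) * h1 + (s ^ 2 * y ^ 2) * h2 +
      (x ^ 2 * c * t - y ^ 2 * d * s) * hD
  rw [← sub_nonneg, key]
  rcases hs with hs | hs
  · exact div_nonneg (sq_nonneg _) (mul_nonneg hs h.le)
  · simp [hs]

/-- Adding a multiple of `cos` changes the area form of an arc by a telescoping difference. -/
theorem arc_quadratic_add_cos {θ φ : ℝ} (x y a : ℝ) (h : 0 < Real.sin (φ - θ)) :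
    (2 * (x + a * Real.cos θ) * (y + a * Real.cos φ) - Real.cos (φ - θ) *
        ((x + a * Real.cos θ) ^ 2 + (y + a * Real.cos φ) ^ 2)) / Real.sin (φ - θ) =
      (2 * x * y - Real.cos (φ - θ) * (x ^ 2 + y ^ 2)) / Real.sin (φ - θ) +
        ((2 * a * y * Real.sin φ + a ^ 2 * Real.sin φ * Real.cos φ) -
          (2 * a * x * Real.sin θ + a ^ 2 * Real.sin θ * Real.cos θ)) := by
  rw [Real.sin_sub] at *
  rw [Real.cos_sub]
  have h1 := Real.sin_sq_add_cos_sq θ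
  have h2 := Real.sin_sq_add_cos_sq φ
  have := h.ne'
  generalize Real.sin θ = s at *
  generalize Real.sin φ = t at *
  generalize Real.cos θ = c at *
  generalize Real.cos φ = d at *
  obtain ⟨D, hD⟩ : ∃ D, D = t * c - d * s := ⟨_, rfl⟩
  rw [← hD] at this ⊢
  rw [div_add' _ _ _ this, div_left_inj' this, hD]
  linear_combination (-2 * a * x * d - a ^ 2 * c * d) * h1 +
    (-2 * a * y * c - a ^ 2 * c * d) * h2

/-- The area form is nonpositive on the hyperplane of support functions `h` with
`h 0 + h π = 0`, where the angle `π` lies on the arc from `θ k` to `θ (k + 1)`. -/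
theorem sum_arc_quadratic_nonpos {m k : ℕ} {θ U : ℕ → ℝ} (hk : k < m) (h0 : θ 0 = 0)
    (hθm : θ m = 2 * Real.pi) (hpos : ∀ j, 0 < θ (j + 1) - θ j)
    (hlt : ∀ j, θ (j + 1) - θ j < Real.pi)
    (hkle : θ k ≤ Real.pi) (hklt : Real.pi < θ (k + 1)) (hU : U m = U 0)
    (hl : Real.sin (θ (k + 1)) * (U k - U 0 * Real.cos (θ k)) =
      Real.sin (θ k) * (U (k + 1) - U 0 * Real.cos (θ (k + 1)))) :
    ∑ j ∈ Finset.range m, (2 * U j * U (j + 1) - Real.cos (θ (j + 1) - θ j) *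
      (U j ^ 2 + U (j + 1) ^ 2)) / Real.sin (θ (j + 1) - θ j) ≤ 0 := by
  have hmono : StrictMono θ := strictMono_nat_of_lt_succ fun j => by linarith [hpos j]
  have hsin : ∀ j, 0 < Real.sin (θ (j + 1) - θ j) := fun j =>
    Real.sin_pos_of_pos_of_lt_pi (hpos j) (hlt j)
  have hupper : ∀ j, k + 1 ≤ j → j ≤ m → Real.sin (θ j) ≤ 0 ∧ (j ≠ m → Real.sin (θ j) < 0) := by
    intro j hkj hjm
    have h1 : Real.pi < θ j := hklt.trans_le (hmono.monotone hkj)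
    have h2 : θ j ≤ 2 * Real.pi := hθm ▸ hmono.monotone hjm
    have heq : Real.sin (θ j) = - Real.sin (θ j - Real.pi) := by rw [Real.sin_sub_pi, neg_neg]
    rw [heq]
    refine ⟨neg_nonpos.2 (Real.sin_nonneg_of_nonneg_of_le_pi (by linarith) (by linarith)),
      fun hne => neg_neg_iff_pos.2 (Real.sin_pos_of_pos_of_lt_pi (by linarith) ?_)⟩
    have : θ j < 2 * Real.pi := hθm ▸ hmono (lt_of_le_of_ne hjm hne)
    linarith
  have hlower : ∀ j, j ≤ k → 0 ≤ Real.sin (θ j) := fun j hj =>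
    Real.sin_nonneg_of_nonneg_of_le_pi (h0 ▸ hmono.monotone (Nat.zero_le j))
      ((hmono.monotone hj).trans hkle)
  have hk1 : k + 1 ≠ m := by
    rintro rfl
    linarith [hlt k]
  set W : ℕ → ℝ := fun j => U j - U 0 * Real.cos (θ j) with hW
  have hW0 : W 0 = 0 := by simp [hW, h0]
  have hWm : W m = 0 := by simp [hW, hU, hθm]
  have hzero : ∀ j ≤ m, Real.sin (θ j) = 0 → W j = 0 := by
    intro j hjm hj
    rcases Nat.lt_or_ge k j with hkj | hjk
    · by_cases hne : j = m
      · rw [hne, hWm]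
      · exact absurd hj ((hupper j hkj hjm).2 hne).ne
    · rcases Nat.eq_zero_or_pos j with rfl | hj0
      · exact hW0
      have hθj : 0 < θ j := h0 ▸ hmono hj0
      rcases hjk.lt_or_eq with hlt' | rfl
      · exact absurd hj (Real.sin_pos_of_pos_of_lt_pi hθj ((hmono hlt').trans_le hkle)).ne'
      · rw [hj, zero_mul] at hl
        exact (mul_eq_zero.1 hl).resolve_left ((hupper _ le_rfl hk).2 hk1).ne
  set T : ℕ → ℝ := fun j => 2 * U 0 * W j * Real.sin (θ j) +
    U 0 ^ 2 * Real.sin (θ j) * Real.cos (θ j) - W j ^ 2 * Real.cos (θ j) / Real.sin (θ j) with hT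
  have hterm : ∀ j ∈ Finset.range m, (2 * U j * U (j + 1) - Real.cos (θ (j + 1) - θ j) *
      (U j ^ 2 + U (j + 1) ^ 2)) / Real.sin (θ (j + 1) - θ j) ≤ T (j + 1) - T j := by
    intro j hj
    have hjm : j < m := Finset.mem_range.1 hj
    have hs : 0 ≤ Real.sin (θ j) * Real.sin (θ (j + 1)) ∨
        Real.sin (θ (j + 1)) * W j = Real.sin (θ j) * W (j + 1) := by
      rcases lt_trichotomy j k with hjk | rfl | hkj
      · exact Or.inl (mul_nonneg (hlower j hjk.le) (hlower (j + 1) hjk))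
      · exact Or.inr hl
      · exact Or.inl (mul_nonneg_of_nonpos_of_nonpos (hupper j hkj hjm.le).1
          (hupper (j + 1) (by omega) hjm).1)
    have hle := arc_quadratic_le (hsin j) (hzero j hjm.le) (hzero (j + 1) hjm) hs
    have hadd := arc_quadratic_add_cos (W j) (W (j + 1)) (U 0) (hsin j)
    have hUW : ∀ i, W i + U 0 * Real.cos (θ i) = U i := fun i => by simp [hW]
    rw [hUW, hUW] at hadd
    rw [hadd]
    simp only [hT]
    linarith
  refine (Finset.sum_le_sum hterm).trans (le_of_eq ?_)
  rw [Finset.sum_range_sub]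
  simp [hT, hW0, hWm, h0, hθm]

theorem ZMod.sum_eq_sum_range {m : ℕ} [NeZero m] {M : Type*} [AddCommMonoid M] (f : ZMod m → M) :
    ∑ j, f j = ∑ i ∈ Finset.range m, f (i : ZMod m) := by
  refine Finset.sum_nbij' ZMod.val (fun i => (i : ZMod m)) ?_ ?_ ?_ ?_ ?_
  · exact fun j _ => Finset.mem_range.2 (ZMod.val_lt j)
  · exact fun _ _ => Finset.mem_univ _
  · exact fun j _ => ZMod.natCast_zmod_val j
  · exact fun i hi => ZMod.val_cast_of_lt (Finset.mem_range.1 hi)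
  · exact fun j _ => by rw [ZMod.natCast_zmod_val]

theorem exists_polygonHessian_nonpos_on_ker {m : ℕ} [NeZero m] (hm : 3 ≤ m) (α : ZMod m → ℝ)
    (hα : ∀ j, 0 < α j ∧ α j < Real.pi) (hsum : ∑ j, α j = 2 * Real.pi) :
    ∃ l : (ZMod m → ℝ) →ₗ[ℝ] ℝ, ∀ u, l u = 0 → u ⬝ᵥ (polygonHessian m α).mulVec u ≤ 0 := by
  set θ : ℕ → ℝ := fun n => ∑ i ∈ Finset.range n, α (i : ZMod m) with hθ
  have h0 : θ 0 = 0 := by simp [hθ]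
  have hθm : θ m = 2 * Real.pi := by rw [← hsum, ZMod.sum_eq_sum_range]
  have hstep : ∀ j, θ (j + 1) - θ j = α (j : ZMod m) := fun j => by
    simp [hθ, Finset.sum_range_succ]
  obtain ⟨k, hk, hkle, hklt⟩ : ∃ k < m, θ k ≤ Real.pi ∧ Real.pi < θ (k + 1) := by
    by_contra! hcon
    have : ∀ n ≤ m, θ n ≤ Real.pi := by
      intro n
      induction n with
      | zero => exact fun _ => h0 ▸ Real.pi_pos.le
      | succ n ih => exact fun hn => hcon n hn (ih (Nat.le_of_succ_le hn))
    linarith [this m le_rfl, Real.pi_pos]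
  let e : ℕ → (ZMod m → ℝ) →ₗ[ℝ] ℝ := fun n => LinearMap.proj (n : ZMod m)
  refine ⟨Real.sin (θ (k + 1)) • (e k - Real.cos (θ k) • e 0) -
    Real.sin (θ k) • (e (k + 1) - Real.cos (θ (k + 1)) • e 0), fun u hu => ?_⟩
  rw [polygonHessian_quadratic hm, ZMod.sum_eq_sum_range]
  have h := sum_arc_quadratic_nonpos (U := fun n => u (n : ZMod m)) hk h0 hθm
    (fun j => by rw [hstep]; exact (hα _).1) (fun j => by rw [hstep]; exact (hα _).2)
    hkle hklt (by simp) (by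
      simp only [e, LinearMap.sub_apply, LinearMap.smul_apply, LinearMap.proj_apply,
        smul_eq_mul] at hu
      linarith)
  simpa only [hstep, Nat.cast_add, Nat.cast_one] using h

/-- If `g` is a convex `m`-gon (all edge lengths `(M·g)ⱼ` nonnegative) with positive area
`⟨g, M·g⟩ > 0`, then on the hyperplane `⟨u, M·g⟩ = 0` (stationary area) the form
`⟨u, M·u⟩` is nonpositive, and vanishes iff all edge lengths are stationary, `M·u = 0`. -/
theorem polygonHessian_negative_on_area_orthogonal (m : ℕ) [NeZero m] (hm : 3 ≤ m)
    (α : ZMod m → ℝ) (hα : ∀ j, 0 < α j ∧ α j < Real.pi)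
    (hsum : ∑ j, α j = 2 * Real.pi)
    (g u : ZMod m → ℝ)
    (hg : ∀ j, 0 ≤ (polygonHessian m α).mulVec g j)
    (hgpos : 0 < g ⬝ᵥ (polygonHessian m α).mulVec g)
    (hu : u ⬝ᵥ (polygonHessian m α).mulVec g = 0) :
    u ⬝ᵥ (polygonHessian m α).mulVec u ≤ 0 ∧
    (u ⬝ᵥ (polygonHessian m α).mulVec u = 0 ↔ (polygonHessian m α).mulVec u = 0) := by
  obtain ⟨l, hl⟩ := exists_polygonHessian_nonpos_on_ker hm α hα hsum
  exact (polygonHessian_isSymm hm α).nonpos_on_orthogonal_of_nonpos_on_ker l hl hgpos hu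
end
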